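/- arXiv:1809.02900 — 9 statements merged into one kernel-verified Lean document; each statement's English description precedes it below -/
import Mathlib

section
/- Galitskii–Migdal formula. Let A be a real symmetric positive definite N×N matrix and v a real symmetric positive semidefinite N×N matrix. Then the internal energy E := ⟨(1/2) xᵀA x + U(x)⟩ is finite and satisfies E = (1/4)·Tr[A G + I], where G is the Green's function of the Gibbs model and I is the N×N identity matrix. -/
open MeasureTheory Matrix

noncomputable section

/-- The generalized Coulomb interaction `U(x) = (1/8) ∑_{i,j} v_{ij} x_i² x_j²`. -/
def interaction {N : ℕ} (v : Matrix (Fin N) (Fin N) ℝ) (x : Fin N → ℝ) : ℝ :=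
  (1 / 8) * ∑ i, ∑ j, v i j * x i ^ 2 * x j ^ 2

/-- The partition function `Z = ∫ exp(−(1/2) xᵀA x − U(x)) dx`. -/
def partitionFunction {N : ℕ} (A v : Matrix (Fin N) (Fin N) ℝ) : ℝ :=
  ∫ x : Fin N → ℝ, Real.exp (-(1 / 2) * (x ⬝ᵥ A.mulVec x) - interaction v x)

/-- The (interacting) Green's function `G_{ij} = ⟨x_i x_j⟩`. -/
def greensFunction {N : ℕ} (A v : Matrix (Fin N) (Fin N) ℝ) : Matrix (Fin N) (Fin N) ℝ :=
  Matrix.of fun i j =>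
    (partitionFunction A v)⁻¹ *
      ∫ x : Fin N → ℝ, x i * x j * Real.exp (-(1 / 2) * (x ⬝ᵥ A.mulVec x) - interaction v x)

theorem interaction_nonneg {N : ℕ} {v : Matrix (Fin N) (Fin N) ℝ} (hv : v.PosSemidef)
    (x : Fin N → ℝ) : 0 ≤ interaction v x := by
  have h := hv.dotProduct_mulVec_nonneg (fun i => x i ^ 2)
  have e : star (fun i => x i ^ 2) ⬝ᵥ v *ᵥ (fun i => x i ^ 2)
      = ∑ i, ∑ j, v i j * x i ^ 2 * x j ^ 2 := by
    simp only [dotProduct, mulVec, star_trivial, Finset.mul_sum]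
    exact Finset.sum_congr rfl fun i _ => Finset.sum_congr rfl fun j _ => by ring
  rw [e] at h
  unfold interaction
  positivity

theorem continuous_interaction {N : ℕ} (v : Matrix (Fin N) (Fin N) ℝ) :
    Continuous (interaction v) := by
  unfold interaction
  fun_prop

theorem interaction_smul {N : ℕ} (v : Matrix (Fin N) (Fin N) ℝ) (t : ℝ) (x : Fin N → ℝ) :
    interaction v (t • x) = t ^ 4 * interaction v x := by
  simp only [interaction, Pi.smul_apply, smul_eq_mul, Finset.mul_sum]
  exact Finset.sum_congr rfl fun i _ => Finset.sum_congr rfl fun j _ => by ring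

theorem smul_dotProduct_mulVec_smul {N : ℕ} (A : Matrix (Fin N) (Fin N) ℝ) (t : ℝ)
    (x : Fin N → ℝ) : (t • x) ⬝ᵥ A.mulVec (t • x) = t ^ 2 * (x ⬝ᵥ A.mulVec x) := by
  rw [mulVec_smul, smul_dotProduct, dotProduct_smul, smul_eq_mul, smul_eq_mul]
  ring

theorem continuous_dotProduct_mulVec {N : ℕ} (A : Matrix (Fin N) (Fin N) ℝ) :
    Continuous fun x : Fin N → ℝ => x ⬝ᵥ A.mulVec x := by
  simp only [dotProduct, mulVec]
  fun_prop

/-- A positive definite quadratic form is coercive. -/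
theorem exists_pos_mul_norm_sq_le {N : ℕ} {A : Matrix (Fin N) (Fin N) ℝ} (hA : A.PosDef) :
    ∃ l > 0, ∀ x : Fin N → ℝ, l * ‖x‖ ^ 2 ≤ x ⬝ᵥ A.mulVec x := by
  rcases (Metric.sphere (0 : Fin N → ℝ) 1).eq_empty_or_nonempty with he | hne
  · refine ⟨1, one_pos, fun x => ?_⟩
    have hx : x = 0 := by
      by_contra hx
      have : ‖x‖⁻¹ • x ∈ Metric.sphere (0 : Fin N → ℝ) 1 := by
        simp [norm_smul, hx]
      simp [he] at this
    simp [hx]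
  · obtain ⟨y, hy, hmin⟩ := (isCompact_sphere (0 : Fin N → ℝ) 1).exists_isMinOn hne
      (continuous_dotProduct_mulVec A).continuousOn
    have hy0 : y ≠ 0 := by
      rintro rfl
      simp at hy
    refine ⟨y ⬝ᵥ A.mulVec y, by simpa using hA.dotProduct_mulVec_pos hy0, fun x => ?_⟩
    by_cases hx : x = 0
    · simp [hx]
    have hn : 0 < ‖x‖ := norm_pos_iff.2 hx
    have h := isMinOn_iff.1 hmin (‖x‖⁻¹ • x) (by simp [norm_smul, hx])
    rw [smul_dotProduct_mulVec_smul, inv_pow, inv_mul_eq_div, le_div_iff₀ (by positivity)] at h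
    exact h

theorem integrable_exp_neg_mul_norm_sq {N : ℕ} {c : ℝ} (hc : 0 < c) :
    Integrable fun x : Fin N → ℝ => Real.exp (-c * ‖x‖ ^ 2) := by
  have hb : 0 < c / (N + 1) := by positivity
  have h : Integrable fun x : Fin N → ℝ => ∏ i, Real.exp (-(c / (N + 1)) * x i ^ 2) :=
    Integrable.fintype_prod fun _ => integrable_exp_neg_mul_sq hb
  refine h.mono' (by fun_prop) (ae_of_all _ fun x => ?_)
  rw [Real.norm_eq_abs, Real.abs_exp, ← Real.exp_sum, Real.exp_le_exp, ← Finset.mul_sum]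
  have hs : ∑ i, x i ^ 2 ≤ N * ‖x‖ ^ 2 := by
    have := Finset.sum_le_card_nsmul Finset.univ (fun i => x i ^ 2) (‖x‖ ^ 2) fun i _ => by
      rw [← sq_abs]
      gcongr
      exact norm_le_pi_norm x i
    simpa using this
  have h2 : c / (N + 1) * ∑ i, x i ^ 2 ≤ c * ‖x‖ ^ 2 := by
    rw [div_mul_eq_mul_div, div_le_iff₀ (by positivity), mul_assoc]
    gcongr
    nlinarith [sq_nonneg ‖x‖]
  linarith

theorem mul_exp_neg_mul_le {c s : ℝ} (hc : 0 < c) :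
    s * Real.exp (-c * s) ≤ 2 / c * Real.exp (-(c / 2) * s) := by
  have h : c / 2 * s ≤ Real.exp (c / 2 * s) := by linarith [Real.add_one_le_exp (c / 2 * s)]
  have e : Real.exp (-(c / 2) * s) = Real.exp (c / 2 * s) * Real.exp (-c * s) := by
    rw [← Real.exp_add]
    ring_nf
  have hs : s ≤ 2 / c * Real.exp (c / 2 * s) := by
    rw [div_mul_eq_mul_div, le_div_iff₀ hc]
    linarith
  rw [e, ← mul_assoc]
  gcongr

/-- The action `S` of a coercive model satisfies `S exp(−c S) ∈ L¹`. -/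
theorem integrable_mul_exp_neg_mul {N : ℕ} {S : (Fin N → ℝ) → ℝ} (hS : Continuous S) {l : ℝ}
    (hl : 0 < l) (hlS : ∀ x, l * ‖x‖ ^ 2 ≤ S x) {c : ℝ} (hc : 0 < c) :
    Integrable fun x => S x * Real.exp (-c * S x) := by
  have hi := (integrable_exp_neg_mul_norm_sq (N := N) (c := c / 2 * l) (by positivity)).const_mul
    (2 / c)
  refine hi.mono' (by fun_prop) (ae_of_all _ fun x => ?_)
  have h0 : 0 ≤ S x := le_trans (by positivity) (hlS x)
  rw [Real.norm_of_nonneg (by positivity)]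
  refine (mul_exp_neg_mul_le hc).trans ?_
  refine mul_le_mul_of_nonneg_left (Real.exp_le_exp.2 ?_) (by positivity)
  linarith [mul_le_mul_of_nonneg_left (hlS x) (half_pos hc).le]

theorem integrable_exp_neg_of_coercive {N : ℕ} {S : (Fin N → ℝ) → ℝ} (hS : Continuous S) {l : ℝ}
    (hl : 0 < l) (hlS : ∀ x, l * ‖x‖ ^ 2 ≤ S x) :
    Integrable fun x => Real.exp (-S x) := by
  refine (integrable_exp_neg_mul_norm_sq hl).mono' (by fun_prop) (ae_of_all _ fun x => ?_)
  rw [Real.norm_eq_abs, Real.abs_exp, Real.exp_le_exp]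
  linarith [hlS x]

/-- Virial identity, obtained by differentiating the rescaled partition function at scale one. -/
theorem integral_virial {N : ℕ} {Q U : (Fin N → ℝ) → ℝ} (hQ : Continuous Q) (hU : Continuous U)
    (hU0 : ∀ x, 0 ≤ U x) {l : ℝ} (hl : 0 < l) (hlQ : ∀ x, l * ‖x‖ ^ 2 ≤ Q x)
    (hQs : ∀ (t : ℝ) x, Q (t • x) = t ^ 2 * Q x) (hUs : ∀ (t : ℝ) x, U (t • x) = t ^ 4 * U x) :
    ∫ x, (2 * Q x + 4 * U x) * Real.exp (-(Q x + U x)) = N * ∫ x, Real.exp (-(Q x + U x)) := by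
  have hQ0 : ∀ x, 0 ≤ Q x := fun x => le_trans (by positivity) (hlQ x)
  have hlS : ∀ x, l * ‖x‖ ^ 2 ≤ Q x + U x := fun x => by linarith [hlQ x, hU0 x]
  have hd := (hasDerivAt_integral_of_dominated_loc_of_deriv_le (μ := volume) (x₀ := (1 : ℝ))
    (s := Metric.ball 1 (1 / 2))
    (F := fun t x => Real.exp (-(t ^ 2 * Q x + t ^ 4 * U x)))
    (F' := fun t x => -(2 * t * Q x + 4 * t ^ 3 * U x) * Real.exp (-(t ^ 2 * Q x + t ^ 4 * U x)))
    (bound := fun x => 14 * ((Q x + U x) * Real.exp (-(1 / 16) * (Q x + U x))))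
    (Metric.ball_mem_nhds _ (by norm_num))
    (.of_forall fun t => by fun_prop)
    (by simpa using integrable_exp_neg_of_coercive (hQ.add hU) hl hlS)
    (by fun_prop)
    (ae_of_all _ fun x t ht => by
      rw [Metric.mem_ball, Real.dist_eq, abs_lt] at ht
      have h1 : 1 / 2 ≤ t := by linarith
      have h2 : t ≤ 3 / 2 := by linarith
      have hq := hQ0 x
      have hu := hU0 x
      have t2 : (1 / 2) ^ 2 ≤ t ^ 2 := by gcongr
      have t4 : (1 / 2) ^ 4 ≤ t ^ 4 := by gcongr
      have t3 : t ^ 3 ≤ (3 / 2) ^ 3 := by gcongr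
      rw [norm_mul, norm_neg, Real.norm_of_nonneg (by positivity), Real.norm_eq_abs, Real.abs_exp,
        ← mul_assoc]
      gcongr
      · nlinarith [mul_le_mul_of_nonneg_right h2 hq, mul_le_mul_of_nonneg_right t3 hu]
      · nlinarith [mul_le_mul_of_nonneg_right t2 hq, mul_le_mul_of_nonneg_right t4 hu])
    ((integrable_mul_exp_neg_mul (hQ.add hU) hl hlS (by norm_num)).const_mul 14)
    (ae_of_all _ fun x t _ => by
      have h := ((((hasDerivAt_id t).pow 2).mul_const (Q x)).add
        (((hasDerivAt_id t).pow 4).mul_const (U x))).neg.exp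
      refine h.congr_deriv ?_
      simp only [id_eq, Pi.add_apply, Pi.neg_apply, Pi.pow_apply]
      norm_num
      ring)).2
  have hscale : (fun t : ℝ => ∫ x, Real.exp (-(t ^ 2 * Q x + t ^ 4 * U x))) =ᶠ[nhds 1]
      fun t => (t ^ N)⁻¹ * ∫ x, Real.exp (-(Q x + U x)) := by
    filter_upwards [lt_mem_nhds one_pos] with t ht
    have h := Measure.integral_comp_smul (volume : Measure (Fin N → ℝ))
      (fun x => Real.exp (-(Q x + U x))) t
    simp only [hQs, hUs, smul_eq_mul, Module.finrank_fin_fun] at h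
    rw [h, abs_of_pos (by positivity)]
  have hr : HasDerivAt (fun t : ℝ => (t ^ N)⁻¹ * ∫ x, Real.exp (-(Q x + U x)))
      (-N * ∫ x, Real.exp (-(Q x + U x))) 1 := by
    have h := ((hasDerivAt_pow N (1 : ℝ)).inv (by simp)).mul_const
      (∫ x, Real.exp (-(Q x + U x)))
    refine h.congr_deriv ?_
    simp
  have h := hd.unique (hr.congr_of_eventuallyEq hscale)
  simp only [one_pow, one_mul, mul_one, neg_mul, integral_neg] at h
  linarith

/-- **Galitskii–Migdal formula**: the internal energy
`E = ⟨(1/2) xᵀA x + U(x)⟩` is finite and `E = (1/4)·Tr[A G + I]`. -/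
theorem galitskii_migdal {N : ℕ} (hN : 1 ≤ N) (A v : Matrix (Fin N) (Fin N) ℝ)
    (hA : A.PosDef) (hv : v.PosSemidef) :
    Integrable (fun x : Fin N → ℝ =>
      ((1 / 2) * (x ⬝ᵥ A.mulVec x) + interaction v x) *
        Real.exp (-(1 / 2) * (x ⬝ᵥ A.mulVec x) - interaction v x)) ∧
    (partitionFunction A v)⁻¹ *
        (∫ x : Fin N → ℝ,
          ((1 / 2) * (x ⬝ᵥ A.mulVec x) + interaction v x) *
            Real.exp (-(1 / 2) * (x ⬝ᵥ A.mulVec x) - interaction v x))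
      = (1 / 4) * (A * greensFunction A v + 1).trace := by
  obtain ⟨l, hl, hlA⟩ := exists_pos_mul_norm_sq_le hA
  have hQ : Continuous fun x : Fin N → ℝ => (1 / 2) * (x ⬝ᵥ A.mulVec x) :=
    continuous_const.mul (continuous_dotProduct_mulVec A)
  have hU := continuous_interaction v
  have hQU : Continuous fun x : Fin N → ℝ => (1 / 2) * (x ⬝ᵥ A.mulVec x) + interaction v x :=
    hQ.add hU
  have hU0 := interaction_nonneg hv
  have hlQ : ∀ x : Fin N → ℝ, l / 2 * ‖x‖ ^ 2 ≤ (1 / 2) * (x ⬝ᵥ A.mulVec x) := fun x => by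
    linarith [hlA x]
  have hlS : ∀ x : Fin N → ℝ, l / 2 * ‖x‖ ^ 2 ≤ (1 / 2) * (x ⬝ᵥ A.mulVec x) + interaction v x :=
    fun x => by linarith [hlQ x, hU0 x]
  have hexp : ∀ x : Fin N → ℝ, -(1 / 2) * (x ⬝ᵥ A.mulVec x) - interaction v x
      = -((1 / 2) * (x ⬝ᵥ A.mulVec x) + interaction v x) := fun x => by ring
  have hvir := integral_virial hQ hU hU0 (half_pos hl) hlQ
    (fun t x => by rw [smul_dotProduct_mulVec_smul]; ring) (interaction_smul v)
  have hS := integrable_mul_exp_neg_mul hQU (half_pos hl) hlS one_pos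
  have hZ := integral_exp_pos (integrable_exp_neg_of_coercive hQU (half_pos hl) hlS)
  simp only [neg_mul, one_mul] at hS
  have hG : ∀ i j, Integrable fun x : Fin N → ℝ =>
      x i * x j * Real.exp (-((1 / 2) * (x ⬝ᵥ A.mulVec x) + interaction v x)) := fun i j => by
    refine (hS.const_mul (2 / l)).mono' (by fun_prop) (ae_of_all _ fun x => ?_)
    rw [norm_mul, Real.norm_eq_abs (Real.exp _), Real.abs_exp, ← mul_assoc]
    gcongr
    have hx : ‖x i * x j‖ ≤ ‖x‖ ^ 2 := by
      rw [norm_mul, sq]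
      gcongr <;> exact norm_le_pi_norm x _
    rw [div_mul_eq_mul_div, le_div_iff₀ hl]
    nlinarith [hlS x]
  have hform : ∀ x : Fin N → ℝ, (x ⬝ᵥ A.mulVec x) *
      Real.exp (-((1 / 2) * (x ⬝ᵥ A.mulVec x) + interaction v x)) = ∑ i, ∑ j, A i j *
        (x j * x i * Real.exp (-((1 / 2) * (x ⬝ᵥ A.mulVec x) + interaction v x))) := fun x => by
    generalize Real.exp _ = w
    simp only [dotProduct, mulVec, Finset.mul_sum, Finset.sum_mul]
    exact Finset.sum_congr rfl fun i _ => Finset.sum_congr rfl fun j _ => by ring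
  have hQi : Integrable fun x : Fin N → ℝ => (x ⬝ᵥ A.mulVec x) *
      Real.exp (-((1 / 2) * (x ⬝ᵥ A.mulVec x) + interaction v x)) := by
    simp only [hform]
    exact integrable_finsetSum _ fun i _ => integrable_finsetSum _ fun j _ =>
      (hG j i).const_mul _
  have htr : (A * greensFunction A v).trace = (partitionFunction A v)⁻¹ *
      ∫ x : Fin N → ℝ, (x ⬝ᵥ A.mulVec x) *
        Real.exp (-((1 / 2) * (x ⬝ᵥ A.mulVec x) + interaction v x)) := by
    have hint : ∫ x : Fin N → ℝ, (x ⬝ᵥ A.mulVec x) *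
        Real.exp (-((1 / 2) * (x ⬝ᵥ A.mulVec x) + interaction v x)) = ∑ i, ∑ j, A i j *
        ∫ x : Fin N → ℝ, x j * x i *
          Real.exp (-((1 / 2) * (x ⬝ᵥ A.mulVec x) + interaction v x)) :=
      calc
        _ = _ := integral_congr_ae (ae_of_all _ hform)
        _ = _ := integral_finsetSum _ fun i _ => integrable_finsetSum _ fun j _ =>
          (hG j i).const_mul _
        _ = _ := Finset.sum_congr rfl fun i _ =>
          (integral_finsetSum _ fun j _ => (hG j i).const_mul _).trans
            (Finset.sum_congr rfl fun j _ => integral_const_mul _ _)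
    simp only [hint, trace, diag, mul_apply, greensFunction, of_apply, hexp, Finset.mul_sum]
    exact Finset.sum_congr rfl fun i _ => Finset.sum_congr rfl fun j _ => by ring
  rw [trace_add, htr, trace_one, Fintype.card_fin]
  simp only [partitionFunction, hexp]
  refine ⟨hS, ?_⟩
  have hsplit : ∀ x : Fin N → ℝ, (2 * ((1 / 2) * (x ⬝ᵥ A.mulVec x)) + 4 * interaction v x) *
      Real.exp (-((1 / 2) * (x ⬝ᵥ A.mulVec x) + interaction v x)) =
      4 * (((1 / 2) * (x ⬝ᵥ A.mulVec x) + interaction v x) *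
        Real.exp (-((1 / 2) * (x ⬝ᵥ A.mulVec x) + interaction v x))) -
      (x ⬝ᵥ A.mulVec x) * Real.exp (-((1 / 2) * (x ⬝ᵥ A.mulVec x) + interaction v x)) :=
    fun x => by ring
  simp only [hsplit] at hvir
  rw [integral_sub (hS.const_mul 4) hQi, integral_const_mul] at hvir
  have solve_energy : ∀ z e g n : ℝ, 0 < z → 4 * e - g = n * z →
      z⁻¹ * e = 1 / 4 * (z⁻¹ * g + n) := fun z e g n hz h => by
    field_simp
    linarith
  exact solve_energy _ _ _ _ hZ hvir
end
end

section
/- Isserlis–Wick theorem. Let A be a real symmetric positive definite N×N matrix. For every m ≥ 1 and every choice of indices α₁,…,α_m ∈ {1,…,N}: if m is odd then ⟨x_{α₁}⋯x_{α_m}⟩₀ = 0, and if m is even then ⟨x_{α₁}⋯x_{α_m}⟩₀ = Σ_{σ ∈ Π(I_m)} ∏_{i ∈ I_m/σ} (A⁻¹)_{α_i, α_{σ(i)}}, where the sum runs over all pairings σ of {1,…,m}. -/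
open MeasureTheory Matrix

noncomputable section

/-- The Gaussian partition function `Z₀ = ∫ exp(−(1/2) xᵀA x) dx`. -/
def gaussianPartition {N : ℕ} (A : Matrix (Fin N) (Fin N) ℝ) : ℝ :=
  ∫ x : Fin N → ℝ, Real.exp (-(1 / 2) * (x ⬝ᵥ A.mulVec x))

/-- The Gaussian average `⟨f⟩₀ = Z₀⁻¹ ∫ f(x) exp(−(1/2) xᵀA x) dx`. -/
def gaussianAvg {N : ℕ} (A : Matrix (Fin N) (Fin N) ℝ) (f : (Fin N → ℝ) → ℝ) : ℝ :=
  (gaussianPartition A)⁻¹ * ∫ x : Fin N → ℝ, f x * Real.exp (-(1 / 2) * (x ⬝ᵥ A.mulVec x))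

/-- The set of pairings of `{1,…,m}`: fixed-point-free involutions of `Fin m`. -/
def pairings (m : ℕ) : Finset (Equiv.Perm (Fin m)) :=
  Finset.univ.filter fun σ => σ * σ = 1 ∧ ∀ i, σ i ≠ i

/-- A positive definite quadratic form dominates a positive multiple of the sum of squares. -/
theorem Matrix.PosDef.exists_mul_dotProduct_self_le {ι : Type*} [Fintype ι] {A : Matrix ι ι ℝ}
    (hA : A.PosDef) : ∃ c : ℝ, 0 < c ∧ ∀ x : ι → ℝ, c * (x ⬝ᵥ x) ≤ x ⬝ᵥ A *ᵥ x := by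
  have hcont : Continuous fun x : ι → ℝ => x ⬝ᵥ A *ᵥ x := by fun_prop
  obtain ⟨a, ha, hmin⟩ := (isCompact_sphere (0 : ι → ℝ) 1).exists_forall_le'
    hcont.continuousOn (a := 0) fun x hx => by
      have hx0 : x ≠ 0 := by
        rintro rfl
        simp at hx
      simpa using hA.dotProduct_mulVec_pos hx0
  refine ⟨a / (Fintype.card ι + 1), by positivity, fun x => ?_⟩
  rcases eq_or_ne x 0 with rfl | hx
  · simp
  have hnorm : 0 < ‖x‖ := norm_pos_iff.2 hx
  have hsphere : a ≤ (‖x‖⁻¹ • x) ⬝ᵥ A *ᵥ (‖x‖⁻¹ • x) :=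
    hmin _ (by simp [norm_smul, hnorm.ne'])
  have hquad : a * ‖x‖ ^ 2 ≤ x ⬝ᵥ A *ᵥ x := by
    rw [mulVec_smul, smul_dotProduct, dotProduct_smul, smul_eq_mul, smul_eq_mul] at hsphere
    calc a * ‖x‖ ^ 2 ≤ ‖x‖⁻¹ * (‖x‖⁻¹ * (x ⬝ᵥ A *ᵥ x)) * ‖x‖ ^ 2 := by gcongr
      _ = x ⬝ᵥ A *ᵥ x := by field_simp
  have hsum : x ⬝ᵥ x ≤ (Fintype.card ι + 1) * ‖x‖ ^ 2 := by
    calc x ⬝ᵥ x ≤ ∑ _i : ι, ‖x‖ ^ 2 := by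
          refine Finset.sum_le_sum fun i _ => ?_
          rw [← sq, ← sq_abs]
          gcongr
          exact norm_le_pi_norm x i
      _ ≤ (Fintype.card ι + 1) * ‖x‖ ^ 2 := by
          simp only [Finset.sum_const, Finset.card_univ, nsmul_eq_mul]
          nlinarith [sq_nonneg ‖x‖]
  calc a / (Fintype.card ι + 1) * (x ⬝ᵥ x)
      ≤ a / (Fintype.card ι + 1) * ((Fintype.card ι + 1) * ‖x‖ ^ 2) := by gcongr
    _ = a * ‖x‖ ^ 2 := by field_simp
    _ ≤ x ⬝ᵥ A *ᵥ x := hquad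

/-- Monomials are integrable against a nondegenerate Gaussian weight. -/
theorem integrable_prod_mul_exp_neg_quadratic {ι κ : Type*} [Fintype ι] {A : Matrix ι ι ℝ}
    (hA : A.PosDef) (s : Finset κ) (α : κ → ι) :
    Integrable fun x : ι → ℝ =>
      (∏ i ∈ s, x (α i)) * Real.exp (-(1 / 2) * (x ⬝ᵥ A *ᵥ x)) := by
  classical
  obtain ⟨c, hc, hquad⟩ := hA.exists_mul_dotProduct_self_le
  have hdom : Integrable fun x : ι → ℝ =>
      ∏ k, (x k ^ ((s.filter fun i => α i = k).card : ℝ) * Real.exp (-(c / 2) * x k ^ 2)) :=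
    Integrable.fintype_prod (f := fun k t =>
        t ^ ((s.filter fun i => α i = k).card : ℝ) * Real.exp (-(c / 2) * t ^ 2)) fun k =>
      integrable_rpow_mul_exp_neg_mul_sq (by positivity)
        (neg_one_lt_zero.trans_le (Nat.cast_nonneg _))
  refine hdom.mono (by fun_prop) (Filter.Eventually.of_forall fun x => ?_)
  rw [Finset.prod_mul_distrib, ← Real.exp_sum, norm_mul, norm_mul, Real.norm_eq_abs (Real.exp _),
    Real.norm_eq_abs (Real.exp _), Real.abs_exp, Real.abs_exp]
  have hprod : ∏ k, x k ^ ((s.filter fun i => α i = k).card : ℝ) = ∏ i ∈ s, x (α i) := by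
    rw [← Finset.prod_fiberwise s α]
    refine Finset.prod_congr rfl fun k _ => ?_
    rw [Real.rpow_natCast, Finset.prod_congr rfl (g := fun _ => x k), Finset.prod_const]
    intro i hi
    rw [(Finset.mem_filter.1 hi).2]
  rw [hprod]
  gcongr
  rw [← Finset.mul_sum]
  have := hquad x
  simp only [dotProduct, ← sq] at this ⊢
  linarith

/-- The derivative of the Gaussian weight in the direction of a column of `A⁻¹`. -/
theorem hasLineDerivAt_exp_neg_quadratic {ι : Type*} [Fintype ι] [DecidableEq ι]
    {A : Matrix ι ι ℝ} (hA : A.PosDef) (k : ι) (x : ι → ℝ) :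
    HasLineDerivAt ℝ (fun x : ι → ℝ => Real.exp (-(1 / 2) * (x ⬝ᵥ A *ᵥ x)))
      (-(x k * Real.exp (-(1 / 2) * (x ⬝ᵥ A *ᵥ x)))) x (A⁻¹.col k) := by
  set v := A⁻¹.col k with hv
  have hAv : A *ᵥ v = Pi.single k 1 := by
    rw [hv, ← mulVec_single_one, mulVec_mulVec,
      mul_nonsing_inv _ ((isUnit_iff_isUnit_det A).1 hA.isUnit), one_mulVec]
  have hvA : v ⬝ᵥ A *ᵥ x = x k := by
    have hT : Aᵀ = A := by simpa using hA.isHermitian.eq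
    rw [dotProduct_mulVec, ← mulVec_transpose, hT, hAv, single_one_dotProduct]
  have hquad (t : ℝ) : (x + t • v) ⬝ᵥ A *ᵥ (x + t • v)
      = x ⬝ᵥ A *ᵥ x + t * (2 * x k) + t ^ 2 * v k := by
    simp only [mulVec_add, mulVec_smul, dotProduct_add, add_dotProduct, smul_dotProduct,
      dotProduct_smul, hvA, hAv, dotProduct_single_one, smul_eq_mul,
      Pi.add_apply, Pi.smul_apply]
    ring
  unfold HasLineDerivAt
  simp only [hquad]
  have hpoly : HasDerivAt (fun t : ℝ => x ⬝ᵥ A *ᵥ x + t * (2 * x k) + t ^ 2 * v k)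
      (2 * x k) 0 := by
    convert! (((hasDerivAt_id (0 : ℝ)).mul_const (2 * x k)).const_add (x ⬝ᵥ A *ᵥ x)).add
      ((hasDerivAt_pow 2 (0 : ℝ)).mul_const (v k)) using 1
    simp
  convert! (hpoly.const_mul (-(1 / 2))).exp using 1
  simp
  ring

/-- The derivative of a monomial along a vector. -/
theorem hasLineDerivAt_prod_apply {ι κ : Type*} [DecidableEq κ] (s : Finset κ) (α : κ → ι)
    (x v : ι → ℝ) :
    HasLineDerivAt ℝ (fun x : ι → ℝ => ∏ i ∈ s, x (α i))
      (∑ j ∈ s, (∏ i ∈ s.erase j, x (α i)) * v (α j)) x v := by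
  have h := HasDerivAt.fun_finsetProd (x := (0 : ℝ)) (u := s)
    (f := fun i t => x (α i) + t * v (α i)) (f' := fun i => v (α i)) fun i _ => by
      simpa using ((hasDerivAt_id (0 : ℝ)).mul_const (v (α i))).const_add (x (α i))
  simpa [HasLineDerivAt] using h

/-- Gaussian integration by parts for monomials. -/
theorem integral_apply_mul_prod_mul_exp_neg_quadratic {ι κ : Type*} [Fintype ι] [DecidableEq ι]
    [DecidableEq κ] {A : Matrix ι ι ℝ} (hA : A.PosDef) (k : ι) (s : Finset κ) (α : κ → ι) :
    ∫ x : ι → ℝ, (x k * ∏ i ∈ s, x (α i)) * Real.exp (-(1 / 2) * (x ⬝ᵥ A *ᵥ x))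
      = ∑ j ∈ s, A⁻¹ (α j) k *
          ∫ x : ι → ℝ, (∏ i ∈ s.erase j, x (α i)) *
            Real.exp (-(1 / 2) * (x ⬝ᵥ A *ᵥ x)) := by
  have hint (j : κ) : Integrable fun x : ι → ℝ =>
      A⁻¹ (α j) k * ((∏ i ∈ s.erase j, x (α i)) * Real.exp (-(1 / 2) * (x ⬝ᵥ A *ᵥ x))) :=
    (integrable_prod_mul_exp_neg_quadratic hA (s.erase j) α).const_mul _
  have hsum (x : ι → ℝ) :
      (∑ j ∈ s, (∏ i ∈ s.erase j, x (α i)) * A⁻¹.col k (α j)) *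
          Real.exp (-(1 / 2) * (x ⬝ᵥ A *ᵥ x))
        = ∑ j ∈ s, A⁻¹ (α j) k *
            ((∏ i ∈ s.erase j, x (α i)) * Real.exp (-(1 / 2) * (x ⬝ᵥ A *ᵥ x))) := by
    rw [Finset.sum_mul]
    refine Finset.sum_congr rfl fun j _ => ?_
    rw [col_apply]
    ring
  have hins (x : ι → ℝ) : x k * ∏ i ∈ s, x (α i)
      = ∏ o ∈ Finset.insertNone s, x (o.elim k α) := by
    simp
  have hparts := integral_bilinear_hasLineDerivAt_right_eq_neg_left_of_integrable
    (μ := (volume : Measure (ι → ℝ))) (B := ContinuousLinearMap.mul ℝ ℝ)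
    (f := fun x : ι → ℝ => ∏ i ∈ s, x (α i))
    (f' := fun x => ∑ j ∈ s, (∏ i ∈ s.erase j, x (α i)) * A⁻¹.col k (α j))
    (g := fun x : ι → ℝ => Real.exp (-(1 / 2) * (x ⬝ᵥ A *ᵥ x)))
    (g' := fun x => -(x k * Real.exp (-(1 / 2) * (x ⬝ᵥ A *ᵥ x))))
    (v := A⁻¹.col k)
    (by
      simp only [ContinuousLinearMap.mul_apply', hsum]
      exact integrable_finsetSum _ fun j _ => hint j)
    (by
      refine (integrable_prod_mul_exp_neg_quadratic hA (Finset.insertNone s)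
        fun o => o.elim k α).neg.congr (Filter.Eventually.of_forall fun x => ?_)
      simp only [Pi.neg_apply, ← hins, ContinuousLinearMap.mul_apply']
      ring)
    (integrable_prod_mul_exp_neg_quadratic hA s α)
    (fun x _ => hasLineDerivAt_prod_apply s α x _)
    (fun x _ => hasLineDerivAt_exp_neg_quadratic hA k x)
  simp only [ContinuousLinearMap.mul_apply', hsum, mul_neg, integral_neg, neg_inj] at hparts
  rw [integral_finsetSum _ fun j _ => hint j] at hparts
  simp only [integral_const_mul] at hparts
  rw [← hparts]
  congr 1 with x
  ring

theorem gaussianPartition_ne_zero {N : ℕ} {A : Matrix (Fin N) (Fin N) ℝ} (hA : A.PosDef) :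
    gaussianPartition A ≠ 0 := by
  refine (integral_exp_pos ?_).ne'
  simpa using integrable_prod_mul_exp_neg_quadratic hA (∅ : Finset (Fin N)) id

theorem gaussianAvg_prod_fin_zero {N : ℕ} {A : Matrix (Fin N) (Fin N) ℝ} (hA : A.PosDef)
    (α : Fin 0 → Fin N) : gaussianAvg A (fun x => ∏ i, x (α i)) = 1 := by
  simp only [gaussianAvg, Finset.univ_eq_empty, Finset.prod_empty, one_mul]
  exact inv_mul_cancel₀ (gaussianPartition_ne_zero hA)

theorem gaussianAvg_prod_fin_one {N : ℕ} {A : Matrix (Fin N) (Fin N) ℝ} (hA : A.PosDef)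
    (α : Fin 1 → Fin N) : gaussianAvg A (fun x => ∏ i, x (α i)) = 0 := by
  have h := integral_apply_mul_prod_mul_exp_neg_quadratic hA (α 0) (∅ : Finset (Fin N)) id
  simp only [Finset.prod_empty, mul_one, Finset.sum_empty] at h
  simp only [gaussianAvg, Fin.prod_univ_one, h, mul_zero]

/-- Wick recursion: contract the first factor with each of the others. -/
theorem gaussianAvg_prod_fin_add_two {N : ℕ} {A : Matrix (Fin N) (Fin N) ℝ} (hA : A.PosDef)
    {n : ℕ} (α : Fin (n + 2) → Fin N) :
    gaussianAvg A (fun x => ∏ i, x (α i))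
      = ∑ j : Fin (n + 1), A⁻¹ (α 0) (α j.succ) *
          gaussianAvg A (fun x => ∏ i : Fin n, x (α (j.succAbove i).succ)) := by
  have hsymm (i j : Fin N) : A⁻¹ i j = A⁻¹ j i := by
    simpa using (hA.isHermitian.inv.apply i j).symm
  have herase (j : Fin (n + 1)) (x : Fin N → ℝ) :
      ∏ i ∈ Finset.univ.erase j, x (α i.succ) = ∏ i : Fin n, x (α (j.succAbove i).succ) := by
    rw [← Finset.compl_singleton, ← Fin.image_succAbove_univ,
      Finset.prod_image Fin.succAbove_right_injective.injOn]
  simp only [gaussianAvg, Fin.prod_univ_succ (n := n + 1)]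
  rw [integral_apply_mul_prod_mul_exp_neg_quadratic hA (α 0) Finset.univ
    fun i : Fin (n + 1) => α i.succ, Finset.mul_sum]
  refine Finset.sum_congr rfl fun j _ => ?_
  simp only [herase, hsymm (α 0)]
  ring

theorem mem_pairings {m : ℕ} {σ : Equiv.Perm (Fin m)} :
    σ ∈ pairings m ↔ (∀ i, σ (σ i) = i) ∧ ∀ i, σ i ≠ i := by
  simp [pairings, Equiv.ext_iff]

/-- The increasing enumeration of the complement of `{0, j.succ}`. -/
def finSkipPair {n : ℕ} (j : Fin (n + 1)) : Fin n ↪o Fin (n + 2) :=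
  (Fin.succAboveOrderEmb j).trans (Fin.succOrderEmb (n + 1))

theorem finSkipPair_apply {n : ℕ} (j : Fin (n + 1)) (i : Fin n) :
    finSkipPair j i = (j.succAbove i).succ := rfl

theorem finSkipPair_ne_zero {n : ℕ} (j : Fin (n + 1)) (i : Fin n) : finSkipPair j i ≠ 0 :=
  Fin.succ_ne_zero _

theorem finSkipPair_ne_succ {n : ℕ} (j : Fin (n + 1)) (i : Fin n) :
    finSkipPair j i ≠ j.succ := by
  simp [finSkipPair_apply, Fin.succAbove_ne]

theorem exists_finSkipPair_eq {n : ℕ} {j : Fin (n + 1)} {i : Fin (n + 2)} (h0 : i ≠ 0)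
    (hj : i ≠ j.succ) : ∃ k, finSkipPair j k = i := by
  obtain ⟨i, rfl⟩ := Fin.exists_succ_eq.2 h0
  obtain ⟨k, rfl⟩ := Fin.exists_succAbove_eq (fun h => hj (congrArg Fin.succ h))
  exact ⟨k, rfl⟩

/-- Extend a permutation of the complement of `{0, j.succ}` by the transposition of these two
elements. -/
def adjoinPair {n : ℕ} (j : Fin (n + 1)) (τ : Equiv.Perm (Fin n)) : Equiv.Perm (Fin (n + 2)) :=
  τ.viaFintypeEmbedding (finSkipPair j).toEmbedding * Equiv.swap 0 j.succ

theorem adjoinPair_zero {n : ℕ} (j : Fin (n + 1)) (τ : Equiv.Perm (Fin n)) :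
    adjoinPair j τ 0 = j.succ := by
  rw [adjoinPair, Equiv.Perm.mul_apply, Equiv.swap_apply_left,
    Equiv.Perm.viaFintypeEmbedding_apply_notMem_range]
  rintro ⟨i, hi⟩
  exact finSkipPair_ne_succ j i hi

theorem adjoinPair_succ {n : ℕ} (j : Fin (n + 1)) (τ : Equiv.Perm (Fin n)) :
    adjoinPair j τ j.succ = 0 := by
  rw [adjoinPair, Equiv.Perm.mul_apply, Equiv.swap_apply_right,
    Equiv.Perm.viaFintypeEmbedding_apply_notMem_range]
  rintro ⟨i, hi⟩
  exact finSkipPair_ne_zero j i hi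

theorem adjoinPair_finSkipPair {n : ℕ} (j : Fin (n + 1)) (τ : Equiv.Perm (Fin n)) (i : Fin n) :
    adjoinPair j τ (finSkipPair j i) = finSkipPair j (τ i) := by
  rw [adjoinPair, Equiv.Perm.mul_apply,
    Equiv.swap_apply_of_ne_of_ne (finSkipPair_ne_zero j i) (finSkipPair_ne_succ j i)]
  exact τ.viaFintypeEmbedding_apply_image (finSkipPair j).toEmbedding i

theorem forall_fin_add_two_iff {n : ℕ} (j : Fin (n + 1)) {p : Fin (n + 2) → Prop} :
    (∀ i, p i) ↔ p 0 ∧ p j.succ ∧ ∀ i, p (finSkipPair j i) := by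
  rw [Fin.forall_fin_succ, Fin.forall_iff_succAbove j]
  rfl

theorem adjoinPair_mem_pairings {n : ℕ} {j : Fin (n + 1)} {τ : Equiv.Perm (Fin n)}
    (hτ : τ ∈ pairings n) : adjoinPair j τ ∈ pairings (n + 2) := by
  rw [mem_pairings] at hτ ⊢
  rw [forall_fin_add_two_iff j, forall_fin_add_two_iff j]
  simp [adjoinPair_zero, adjoinPair_succ, adjoinPair_finSkipPair, hτ, (Fin.succ_ne_zero _).symm]

theorem exists_adjoinPair_eq {n : ℕ} {σ : Equiv.Perm (Fin (n + 2))} (hσ : σ ∈ pairings (n + 2)) :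
    ∃ j, ∃ τ ∈ pairings n, adjoinPair j τ = σ := by
  rw [mem_pairings] at hσ
  obtain ⟨hinv, hfix⟩ := hσ
  obtain ⟨j, hj⟩ := Fin.exists_succ_eq.2 (hfix 0)
  have hj' : σ j.succ = 0 := by rw [hj, hinv]
  have hskip (i : Fin n) : ∃ k, finSkipPair j k = σ (finSkipPair j i) := by
    refine exists_finSkipPair_eq (fun h => ?_) (fun h => ?_)
    · exact finSkipPair_ne_succ j i (σ.injective (h.trans hj'.symm))
    · exact finSkipPair_ne_zero j i (σ.injective (h.trans hj))
  choose τ hτ using hskip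
  have hτinv : Function.Involutive τ := fun i => (finSkipPair j).injective (by rw [hτ, hτ, hinv])
  refine ⟨j, hτinv.toPerm, mem_pairings.2 ⟨hτinv, fun i hi => ?_⟩, Equiv.ext ?_⟩
  · have hi' : τ i = i := hi
    exact hfix (finSkipPair j i) (by rw [← hτ, hi'])
  · rw [forall_fin_add_two_iff j]
    exact ⟨by rw [adjoinPair_zero, hj], by rw [adjoinPair_succ, hj'],
      fun i => by rw [adjoinPair_finSkipPair, ← hτ]; rfl⟩

theorem prod_adjoinPair {M : Type*} [CommMonoid M] {n : ℕ} (j : Fin (n + 1))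
    (τ : Equiv.Perm (Fin n)) (f : Fin (n + 2) → Fin (n + 2) → M) :
    ∏ i ∈ Finset.univ.filter (fun i => i < adjoinPair j τ i), f i (adjoinPair j τ i)
      = f 0 j.succ * ∏ i ∈ Finset.univ.filter (fun i => i < τ i),
          f (finSkipPair j i) (finSkipPair j (τ i)) := by
  rw [Finset.prod_filter, Finset.prod_filter, Fin.prod_univ_succ, Fin.prod_univ_succAbove _ j]
  simp [← finSkipPair_apply, adjoinPair_zero, adjoinPair_succ, adjoinPair_finSkipPair]

/-- Classify the pairings of `Fin (n + 2)` by the partner of `0`. -/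
theorem sum_pairings_add_two {R : Type*} [CommSemiring R] {n : ℕ}
    (f : Fin (n + 2) → Fin (n + 2) → R) :
    ∑ σ ∈ pairings (n + 2), ∏ i ∈ Finset.univ.filter (fun i => i < σ i), f i (σ i)
      = ∑ j : Fin (n + 1), f 0 j.succ * ∑ τ ∈ pairings n,
          ∏ i ∈ Finset.univ.filter (fun i => i < τ i),
            f (finSkipPair j i) (finSkipPair j (τ i)) := by
  simp only [Finset.mul_sum, ← Finset.sum_product', ← prod_adjoinPair]
  refine (Finset.sum_bij (fun p _ => adjoinPair p.1 p.2) ?_ ?_ ?_ fun _ _ => rfl).symm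
  · intro p hp
    exact adjoinPair_mem_pairings (Finset.mem_product.1 hp).2
  · rintro ⟨j, τ⟩ - ⟨k, ρ⟩ - h
    dsimp only at h
    have hjk : j = k := Fin.succ_injective _ (by rw [← adjoinPair_zero j τ, h, adjoinPair_zero])
    subst hjk
    congr 1
    ext1 i
    apply (finSkipPair j).injective
    rw [← adjoinPair_finSkipPair, h, adjoinPair_finSkipPair]
  · intro σ hσ
    obtain ⟨j, τ, hτ, rfl⟩ := exists_adjoinPair_eq hσ
    exact ⟨(j, τ), by simp [hτ], rfl⟩

theorem pairings_eq_empty {m : ℕ} (hm : Odd m) : pairings m = ∅ := by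
  induction m using Nat.twoStepInduction with
  | zero => simp at hm
  | one => decide
  | more n ih _ =>
    refine Finset.eq_empty_of_forall_notMem fun σ hσ => ?_
    obtain ⟨j, τ, hτ, -⟩ := exists_adjoinPair_eq hσ
    rw [ih (by simpa [Nat.odd_add] using hm)] at hτ
    simp at hτ

/-- Gaussian moments are sums over pairings, the sum being empty for odd moments. -/
theorem gaussianAvg_prod_eq_sum_pairings {N : ℕ} {A : Matrix (Fin N) (Fin N) ℝ} (hA : A.PosDef)
    (m : ℕ) (α : Fin m → Fin N) :
    gaussianAvg A (fun x => ∏ i, x (α i))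
      = ∑ σ ∈ pairings m,
          ∏ i ∈ Finset.univ.filter (fun i => i < σ i), A⁻¹ (α i) (α (σ i)) := by
  induction m using Nat.twoStepInduction with
  | zero =>
    have h : pairings 0 = {1} := by decide
    rw [gaussianAvg_prod_fin_zero hA]
    simp [h]
  | one => rw [gaussianAvg_prod_fin_one hA, pairings_eq_empty odd_one, Finset.sum_empty]
  | more n ih _ =>
    rw [gaussianAvg_prod_fin_add_two hA, sum_pairings_add_two fun i j => A⁻¹ (α i) (α j)]
    refine Finset.sum_congr rfl fun j _ => ?_
    rw [ih fun i => α (j.succAbove i).succ]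
    rfl

/-- **Isserlis–Wick theorem**: odd Gaussian moments vanish and even Gaussian moments
are given by a sum over pairings of products of entries of `A⁻¹`. -/
theorem isserlis_wick {N : ℕ} (hN : 1 ≤ N) (A : Matrix (Fin N) (Fin N) ℝ) (hA : A.PosDef)
    (m : ℕ) (hm : 1 ≤ m) (α : Fin m → Fin N) :
    gaussianAvg A (fun x => ∏ i, x (α i))
      = if Odd m then 0 else
          ∑ σ ∈ pairings m,
            ∏ i ∈ Finset.univ.filter (fun i => i < σ i), A⁻¹ (α i) (α (σ i)) := by
  rw [gaussianAvg_prod_eq_sum_pairings hA]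
  split_ifs with h
  · rw [pairings_eq_empty h, Finset.sum_empty]
  · rfl
end
end

section
/- Integrability under entrywise nonnegative v with positive diagonal. Let v be a real symmetric N×N matrix with v_{ij} ≥ 0 for all i,j and v_{ii} > 0 for all i, and let U(x) = (1/8) Σ_{i,j=1}^N v_{ij} x_i² x_j². Then there exists c > 0 such that U(x) ≥ c‖x‖⁴ for all x ∈ ℝ^N, and hence for every real symmetric N×N matrix A the function x ↦ exp(−(1/2) xᵀA x − U(x)) is Lebesgue integrable on ℝ^N. -/
open MeasureTheory Matrix

noncomputable section

lemma exists_mul_sq_norm_sq_le_interaction {N : ℕ} (hN : 1 ≤ N) (v : Matrix (Fin N) (Fin N) ℝ)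
    (hvnn : ∀ i j, 0 ≤ v i j) (hvd : ∀ i, 0 < v i i) :
    ∃ c > (0 : ℝ), ∀ x : Fin N → ℝ, c * (∑ i, x i ^ 2) ^ 2 ≤ interaction v x := by
  have : Nonempty (Fin N) := ⟨⟨0, hN⟩⟩
  have hNpos : (0 : ℝ) < N := by exact_mod_cast hN
  obtain ⟨k, hk⟩ := Finite.exists_min fun i => v i i
  refine ⟨v k k / (8 * N), div_pos (hvd k) (by positivity), fun x => ?_⟩
  have hcs : (∑ i, x i ^ 2) ^ 2 ≤ N * ∑ i, (x i ^ 2) ^ 2 := by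
    simpa using sq_sum_le_card_mul_sum_sq (s := Finset.univ) (f := fun i => x i ^ 2)
  have hdiag : v k k * ∑ i, (x i ^ 2) ^ 2 ≤ ∑ i, ∑ j, v i j * x i ^ 2 * x j ^ 2 := by
    rw [Finset.mul_sum]
    refine Finset.sum_le_sum fun i _ => ?_
    calc v k k * (x i ^ 2) ^ 2 ≤ v i i * (x i ^ 2) ^ 2 := by gcongr; exact hk i
      _ = v i i * x i ^ 2 * x i ^ 2 := by ring
      _ ≤ ∑ j, v i j * x i ^ 2 * x j ^ 2 :=
        Finset.single_le_sum (f := fun j => v i j * x i ^ 2 * x j ^ 2)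
          (fun j _ => mul_nonneg (mul_nonneg (hvnn i j) (sq_nonneg _)) (sq_nonneg _))
          (Finset.mem_univ i)
  calc v k k / (8 * N) * (∑ i, x i ^ 2) ^ 2
      ≤ v k k / (8 * N) * (N * ∑ i, (x i ^ 2) ^ 2) := by
        have := hvd k
        gcongr
    _ = 1 / 8 * (v k k * ∑ i, (x i ^ 2) ^ 2) := by field_simp
    _ ≤ interaction v x := by
        unfold interaction
        gcongr

lemma abs_dotProduct_mulVec_le {ι : Type*} [Fintype ι] (A : Matrix ι ι ℝ) (x : ι → ℝ) :
    |x ⬝ᵥ A.mulVec x| ≤ (∑ i, ∑ j, |A i j|) * ∑ i, x i ^ 2 := by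
  have hle (i : ι) : x i ^ 2 ≤ ∑ i, x i ^ 2 :=
    Finset.single_le_sum (f := fun i => x i ^ 2) (fun _ _ => sq_nonneg _) (Finset.mem_univ i)
  have hxy (i j : ι) : |x i| * |x j| ≤ ∑ i, x i ^ 2 := by
    nlinarith [sq_nonneg (|x i| - |x j|), sq_abs (x i), sq_abs (x j), hle i, hle j]
  rw [dotProduct, Finset.sum_mul]
  refine (Finset.abs_sum_le_sum_abs _ _).trans (Finset.sum_le_sum fun i _ => ?_)
  rw [mulVec, dotProduct, Finset.mul_sum, Finset.sum_mul]
  refine (Finset.abs_sum_le_sum_abs _ _).trans (Finset.sum_le_sum fun j _ => ?_)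
  calc |x i * (A i j * x j)| = |A i j| * (|x i| * |x j|) := by rw [abs_mul, abs_mul]; ring
    _ ≤ |A i j| * ∑ i, x i ^ 2 := by gcongr; exact hxy i j

lemma integrable_exp_neg_sum_sq {ι : Type*} [Fintype ι] :
    Integrable fun x : ι → ℝ => Real.exp (-∑ i, x i ^ 2) := by
  have h := Integrable.fintype_prod (μ := fun _ : ι => (volume : Measure ℝ))
    (f := fun _ y => Real.exp (-1 * y ^ 2)) fun _ => integrable_exp_neg_mul_sq one_pos
  simpa [← Real.exp_sum, volume_pi] using h

/-- A quartic lower bound on the interaction dominates any quadratic form. -/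
lemma integrable_exp_of_mul_sq_le_interaction {N : ℕ} (v A : Matrix (Fin N) (Fin N) ℝ)
    {c : ℝ} (hc : 0 < c) (h : ∀ x : Fin N → ℝ, c * (∑ i, x i ^ 2) ^ 2 ≤ interaction v x) :
    Integrable fun x : Fin N → ℝ =>
      Real.exp (-(1 / 2) * (x ⬝ᵥ A.mulVec x) - interaction v x) := by
  set K := 1 / 2 * (∑ i, ∑ j, |A i j|) + 1
  refine (integrable_exp_neg_sum_sq.const_mul (Real.exp (K ^ 2 / (4 * c)))).mono' ?_
    (.of_forall fun x => ?_)
  · refine Continuous.aestronglyMeasurable ?_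
    simp only [interaction, dotProduct, mulVec]
    fun_prop
  · rw [Real.norm_of_nonneg (Real.exp_nonneg _), ← Real.exp_add, Real.exp_le_exp]
    have hA := neg_le_of_abs_le (abs_dotProduct_mulVec_le A x)
    have hq : K * (∑ i, x i ^ 2) - c * (∑ i, x i ^ 2) ^ 2 ≤ K ^ 2 / (4 * c) := by
      rw [le_div_iff₀ (by positivity)]
      nlinarith [sq_nonneg (2 * c * (∑ i, x i ^ 2) - K)]
    simp only [K] at hq ⊢
    linarith [h x]

/-- **Integrability under entrywise nonnegative `v` with positive diagonal**:
if `v` is symmetric with nonnegative entries and strictly positive diagonal, then there is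
`c > 0` with `U(x) ≥ c‖x‖⁴` (here `‖x‖⁴ = (∑_i x_i²)²` for the Euclidean norm), and hence
for every real symmetric `A` the function `exp(−(1/2) xᵀA x − U(x))` is Lebesgue
integrable on `ℝ^N`. -/
theorem integrability_nonneg_v {N : ℕ} (hN : 1 ≤ N) (v : Matrix (Fin N) (Fin N) ℝ)
    (hv : v.IsSymm) (hvnn : ∀ i j, 0 ≤ v i j) (hvd : ∀ i, 0 < v i i) :
    (∃ c > (0 : ℝ), ∀ x : Fin N → ℝ, c * (∑ i, x i ^ 2) ^ 2 ≤ interaction v x) ∧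
    ∀ A : Matrix (Fin N) (Fin N) ℝ, A.IsSymm →
      Integrable (fun x : Fin N → ℝ =>
        Real.exp (-(1 / 2) * (x ⬝ᵥ A.mulVec x) - interaction v x)) := by
  obtain ⟨c, hc, h⟩ := exists_mul_sq_norm_sq_le_interaction hN v hvnn hvd
  exact ⟨⟨c, hc, h⟩, fun A _ => integrable_exp_of_mul_sq_le_interaction v A hc h⟩
end
end

section
/- Asymptotic expansion of the one-dimensional quartic partition function. Let Z_λ = ∫_ℝ exp(−x²/2 − λx⁴/8) dx for λ > 0, and let a_k = (−1)^k 2^{−k+1/2} Γ(2k+1/2) / k!, which equals (1/k!) ∫_ℝ (−x⁴/8)^k exp(−x²/2) dx. Then for every n ∈ ℕ there exist constants C > 0 and δ > 0 such that |Z_λ − Σ_{k=0}^{n} a_k λ^k| ≤ C λ^{n+1} for all 0 < λ < δ; i.e., Σ a_k λ^k is an asymptotic series for Z_λ as λ → 0⁺. -/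
open MeasureTheory

noncomputable section

/-- The one-dimensional quartic partition function `Z_λ = ∫_ℝ exp(−x²/2 − λx⁴/8) dx`. -/
def Zquartic (lam : ℝ) : ℝ :=
  ∫ x : ℝ, Real.exp (-x ^ 2 / 2 - lam * x ^ 4 / 8)

/-- The coefficients `a_k = (−1)^k 2^{−k+1/2} Γ(2k+1/2) / k!`. -/
def aCoeff (k : ℕ) : ℝ :=
  (-1) ^ k * (2 : ℝ) ^ (-(k : ℝ) + 1 / 2) * Real.Gamma (2 * k + 1 / 2) / (k.factorial : ℝ)

/-- Taylor remainder bound for `exp (-t)`, uniform in `t ≥ 0`. -/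
theorem abs_exp_neg_sub_sum_le {t : ℝ} (ht : 0 ≤ t) {N : ℕ} (hN : 0 < N) :
    |Real.exp (-t) - ∑ k ∈ Finset.range N, (-t) ^ k / (k.factorial : ℝ)| ≤ (N + 1) * t ^ N := by
  rcases le_total t 1 with h | h
  · have h1 := Real.exp_bound (x := -t) (by rwa [abs_neg, abs_of_nonneg ht]) hN
    rw [abs_neg, abs_of_nonneg ht] at h1
    refine h1.trans ?_
    rw [mul_comm]
    gcongr
    push_cast
    refine div_le_self (by positivity) ?_
    exact_mod_cast Nat.mul_pos N.factorial_pos hN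
  · have h1 : |Real.exp (-t)| ≤ t ^ N := by
      rw [abs_of_pos (Real.exp_pos _)]
      exact (Real.exp_le_one_iff.2 (by linarith)).trans (one_le_pow₀ h)
    have h2 : |∑ k ∈ Finset.range N, (-t) ^ k / (k.factorial : ℝ)| ≤ N * t ^ N := by
      refine (Finset.abs_sum_le_sum_abs _ _).trans ?_
      refine (Finset.sum_le_card_nsmul _ _ (t ^ N) fun k hk => ?_).trans (by simp)
      rw [abs_div, abs_pow, abs_neg, abs_of_nonneg ht, Nat.abs_cast]
      refine (div_le_self (by positivity) ?_).trans
        (pow_le_pow_right₀ h (Finset.mem_range.1 hk).le)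
      exact_mod_cast k.factorial_pos
    calc _ ≤ _ := abs_sub _ _
      _ ≤ _ := add_le_add h1 h2
      _ = _ := by ring

theorem integrable_pow_mul_exp_neg_sq_div_two (m : ℕ) :
    Integrable fun x : ℝ => x ^ m * Real.exp (-x ^ 2 / 2) := by
  have h := integrable_rpow_mul_exp_neg_mul_sq (b := 1 / 2) (by norm_num) (s := m)
    (by linarith [(Nat.cast_nonneg m : (0 : ℝ) ≤ m)])
  refine h.congr (.of_forall fun x => ?_)
  simp only [Real.rpow_natCast]
  ring_nf

/-- The moments of order `4k` of the unnormalized standard Gaussian. -/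
theorem integral_pow_four_mul_exp_neg_sq_div_two (k : ℕ) :
    ∫ x : ℝ, x ^ (4 * k) * Real.exp (-x ^ 2 / 2)
      = (2 : ℝ) ^ (2 * (k : ℝ) + 1 / 2) * Real.Gamma (2 * k + 1 / 2) := by
  have h0 : (0 : ℝ) ≤ k := k.cast_nonneg
  have habs := integral_comp_abs (f := fun x : ℝ => x ^ (4 * k) * Real.exp (-x ^ 2 / 2))
  have heven : ∀ x : ℝ, |x| ^ (4 * k) = x ^ (4 * k) := fun x =>
    Even.pow_abs ⟨2 * k, by ring⟩ x
  simp only [sq_abs, heven] at habs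
  rw [habs]
  have h := integral_rpow_mul_exp_neg_mul_rpow (p := 2) (q := 4 * k) (b := 1 / 2)
    (by norm_num) (by linarith) (by norm_num)
  have hc : ∫ x in Set.Ioi (0 : ℝ), x ^ (4 * k) * Real.exp (-x ^ 2 / 2)
      = ∫ x in Set.Ioi (0 : ℝ), x ^ (4 * (k : ℝ)) * Real.exp (-(1 / 2) * x ^ (2 : ℝ)) := by
    congr 1
    ext x
    rw [Real.rpow_two, show (4 * (k : ℝ)) = ((4 * k : ℕ) : ℝ) by push_cast; rfl,
      Real.rpow_natCast]
    ring_nf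
  rw [hc, h, show (4 * (k : ℝ) + 1) / 2 = 2 * k + 1 / 2 by ring,
    show -(4 * (k : ℝ) + 1) / 2 = -(2 * k + 1 / 2) by ring, one_div (2 : ℝ),
    Real.inv_rpow (by norm_num), Real.rpow_neg (by norm_num), inv_inv]
  ring

theorem aCoeff_eq_integral (k : ℕ) : aCoeff k
    = (1 / (k.factorial : ℝ)) * ∫ x : ℝ, (-x ^ 4 / 8) ^ k * Real.exp (-x ^ 2 / 2) := by
  have h : ∀ x : ℝ, (-x ^ 4 / 8) ^ k * Real.exp (-x ^ 2 / 2)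
      = ((-1) ^ k / 8 ^ k) * (x ^ (4 * k) * Real.exp (-x ^ 2 / 2)) := fun x => by
    rw [div_pow, neg_pow, ← pow_mul]
    ring
  simp only [h]
  rw [integral_const_mul, integral_pow_four_mul_exp_neg_sq_div_two, aCoeff]
  have h2 : (2 : ℝ) ^ (-(k : ℝ) + 1 / 2) = (2 : ℝ) ^ (2 * (k : ℝ) + 1 / 2) / 8 ^ k := by
    rw [show (8 : ℝ) ^ k = 2 ^ (3 * (k : ℝ)) by
      rw [Real.rpow_mul (by norm_num), Real.rpow_natCast]; norm_num,
      ← Real.rpow_sub (by norm_num)]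
    ring_nf
  rw [h2]
  ring

theorem integrable_quartic_pow_mul_exp (k : ℕ) :
    Integrable fun x : ℝ => (-x ^ 4 / 8) ^ k * Real.exp (-x ^ 2 / 2) := by
  refine ((integrable_pow_mul_exp_neg_sq_div_two (4 * k)).const_mul ((-1) ^ k / 8 ^ k)).congr
    (.of_forall fun x => ?_)
  simp only
  rw [div_pow, neg_pow (x ^ 4), ← pow_mul]
  ring

theorem integrable_exp_quartic {lam : ℝ} (hl : 0 ≤ lam) :
    Integrable fun x : ℝ => Real.exp (-x ^ 2 / 2 - lam * x ^ 4 / 8) := by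
  refine (integrable_pow_mul_exp_neg_sq_div_two 0).mono'
    (by fun_prop) (.of_forall fun x => ?_)
  rw [Real.norm_eq_abs, abs_of_pos (Real.exp_pos _), pow_zero, one_mul]
  have : 0 ≤ lam * x ^ 4 / 8 := by positivity
  exact Real.exp_le_exp.2 (by linarith)

theorem sum_aCoeff_mul_pow_eq_integral (N : ℕ) (lam : ℝ) :
    ∑ k ∈ Finset.range N, aCoeff k * lam ^ k
      = ∫ x : ℝ, (∑ k ∈ Finset.range N, (-(lam * x ^ 4 / 8)) ^ k / (k.factorial : ℝ))
          * Real.exp (-x ^ 2 / 2) := by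
  have h : ∀ (k : ℕ) (x : ℝ), (-(lam * x ^ 4 / 8)) ^ k / (k.factorial : ℝ) * Real.exp (-x ^ 2 / 2)
      = lam ^ k / k.factorial * ((-x ^ 4 / 8) ^ k * Real.exp (-x ^ 2 / 2)) := fun k x => by
    rw [show -(lam * x ^ 4 / 8) = lam * (-x ^ 4 / 8) by ring, mul_pow]
    ring
  simp only [Finset.sum_mul, h]
  rw [integral_finsetSum _ fun k _ => (integrable_quartic_pow_mul_exp k).const_mul _]
  refine Finset.sum_congr rfl fun k _ => ?_
  rw [integral_const_mul, aCoeff_eq_integral]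
  ring

theorem integrable_sum_quartic_mul_exp (N : ℕ) (lam : ℝ) :
    Integrable fun x : ℝ =>
      (∑ k ∈ Finset.range N, (-(lam * x ^ 4 / 8)) ^ k / (k.factorial : ℝ))
        * Real.exp (-x ^ 2 / 2) := by
  simp only [Finset.sum_mul]
  refine integrable_finsetSum _ fun k _ => ?_
  refine ((integrable_quartic_pow_mul_exp k).const_mul (lam ^ k / k.factorial)).congr
    (.of_forall fun x => ?_)
  simp only
  rw [show -(lam * x ^ 4 / 8) = lam * (-x ^ 4 / 8) by ring, mul_pow lam]
  ring

theorem abs_Zquartic_sub_sum_le {lam : ℝ} (hl : 0 ≤ lam) {N : ℕ} (hN : 0 < N) :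
    |Zquartic lam - ∑ k ∈ Finset.range N, aCoeff k * lam ^ k|
      ≤ (N + 1) / 8 ^ N * (∫ x : ℝ, x ^ (4 * N) * Real.exp (-x ^ 2 / 2)) * lam ^ N := by
  rw [Zquartic, sum_aCoeff_mul_pow_eq_integral, ← integral_sub (integrable_exp_quartic hl)
    (integrable_sum_quartic_mul_exp N lam), mul_right_comm, ← integral_const_mul,
    ← Real.norm_eq_abs]
  refine norm_integral_le_of_norm_le
    ((integrable_pow_mul_exp_neg_sq_div_two _).const_mul _) (.of_forall fun x => ?_)
  rw [sub_eq_add_neg (-x ^ 2 / 2), add_comm, Real.exp_add, ← sub_mul, norm_mul,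
    Real.norm_eq_abs, Real.norm_eq_abs, Real.abs_exp, ← mul_assoc]
  refine mul_le_mul_of_nonneg_right ?_ (Real.exp_pos _).le
  refine (abs_exp_neg_sub_sum_le (by positivity) hN).trans_eq ?_
  rw [div_pow, mul_pow, ← pow_mul]
  ring

/-- **Asymptotic expansion of the one-dimensional quartic partition function**:
`a_k = (1/k!) ∫ (−x⁴/8)^k exp(−x²/2) dx`, and for every `n` there are `C > 0`, `δ > 0`
such that `|Z_λ − Σ_{k=0}^n a_k λ^k| ≤ C λ^{n+1}` for all `0 < λ < δ`. -/
theorem quartic_asymptotic_series :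
    (∀ k : ℕ, aCoeff k
        = (1 / (k.factorial : ℝ)) * ∫ x : ℝ, (-x ^ 4 / 8) ^ k * Real.exp (-x ^ 2 / 2)) ∧
    ∀ n : ℕ, ∃ C > (0 : ℝ), ∃ δ > (0 : ℝ), ∀ lam : ℝ, 0 < lam → lam < δ →
      |Zquartic lam - ∑ k ∈ Finset.range (n + 1), aCoeff k * lam ^ k|
        ≤ C * lam ^ (n + 1) := by
  refine ⟨aCoeff_eq_integral, fun n => ⟨_, ?_, 1, one_pos, fun lam hl _ =>
    abs_Zquartic_sub_sum_le hl.le n.succ_pos⟩⟩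
  rw [integral_pow_four_mul_exp_neg_sq_div_two]
  have := Real.Gamma_pos_of_pos (s := 2 * ((n + 1 : ℕ) : ℝ) + 1 / 2) (by positivity)
  positivity
end
end

section
/- Linked cluster expansion (exponential formula for closed diagrams). Let A be a real symmetric positive definite N×N matrix and v a real symmetric N×N matrix. For each n ≥ 0 let z_n = Σ_O F_O/S_O over all 𝐑_n-orbits O of fixed-point-free involutions of H_n (so z₀ = 1), and let c_n = Σ_O F_O/S_O over the connected orbits only (c₀ = 0). Then in the formal power series ring ℝ[[λ]] one has Σ_{n≥0} z_n λ^n = exp( Σ_{n≥1} c_n λ^n ); equivalently, the asymptotic series of the free energy Ω = −log Z is Ω₀ − Σ over connected closed diagrams Γ of F_Γ/S_Γ, with Ω₀ = −log Z₀. -/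
open MeasureTheory Matrix

noncomputable section

/-- The half-edge set `H_n = {1,…,n} × {1,2,3,4}`. -/
abbrev HalfEdge (n : ℕ) := Fin n × Fin 4

/-- A linear position of a half-edge, used to select the first element of each pair. -/
def henc {n : ℕ} (h : HalfEdge n) : ℕ := 4 * (h.1 : ℕ) + (h.2 : ℕ)

/-- Labeled closed Feynman diagrams of order `n`: fixed-point-free involutions of `H_n`. -/
def closedDiagrams (n : ℕ) : Finset (Equiv.Perm (HalfEdge n)) :=
  Finset.univ.filter fun π => π * π = 1 ∧ ∀ h, π h ≠ h

/-- The interaction-line factor. -/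
def vertexFactor {N n : ℕ} (v : Matrix (Fin N) (Fin N) ℝ) (x : HalfEdge n → Fin N)
    (p : Fin n) : ℝ :=
  (-v (x (p, 0)) (x (p, 1))) * (if x (p, 0) = x (p, 2) then (1 : ℝ) else 0) *
    (if x (p, 1) = x (p, 3) then (1 : ℝ) else 0)

/-- The Feynman amplitude `F_π`. -/
def amplitude {N : ℕ} (A v : Matrix (Fin N) (Fin N) ℝ) {n : ℕ}
    (π : Equiv.Perm (HalfEdge n)) : ℝ :=
  ∑ x : HalfEdge n → Fin N,
    (∏ p, vertexFactor v x p) *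
      ∏ h ∈ Finset.univ.filter (fun h => henc h < henc (π h)), A⁻¹ (x h) (x (π h))

/-- Interaction line `p` is adjacent to `q` when `π` pairs a half-edge of `p` with a
half-edge of `q`. -/
def diagStep {n : ℕ} (π : Equiv.Perm (HalfEdge n)) (p q : Fin n) : Prop :=
  ∃ h : HalfEdge n, h.1 = p ∧ (π h).1 = q

/-- A closed diagram of order `n` is connected if `n > 0` and all interaction lines are
mutually reachable. -/
def IsConnectedDiagram {n : ℕ} (π : Equiv.Perm (HalfEdge n)) : Prop :=
  0 < n ∧ ∀ p q : Fin n, Relation.ReflTransGen (diagStep π) p q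

/-- `z_n = Σ_O F_O/S_O` over all unlabeled closed diagrams of order `n`, computed as
`8^{−n}(n!)^{−1} Σ_π F_π` over all labeled closed diagrams (orbit–stabilizer). -/
def zCoeff {N : ℕ} (A v : Matrix (Fin N) (Fin N) ℝ) (n : ℕ) : ℝ :=
  (1 / (8 ^ n * (n.factorial : ℝ))) * ∑ π ∈ closedDiagrams n, amplitude A v π

open scoped Classical in
/-- `c_n = Σ_O F_O/S_O` over connected unlabeled closed diagrams of order `n` (`c₀ = 0`). -/
def cCoeff {N : ℕ} (A v : Matrix (Fin N) (Fin N) ℝ) (n : ℕ) : ℝ :=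
  (1 / (8 ^ n * (n.factorial : ℝ))) *
    ∑ π ∈ closedDiagrams n, if IsConnectedDiagram π then amplitude A v π else 0

section Diagrams

/-- Fixed-point-free involutions of the half-edges over an arbitrary finite vertex type. -/
def diagramsOn (V : Type*) [Fintype V] [DecidableEq V] : Finset (Equiv.Perm (V × Fin 4)) :=
  Finset.univ.filter fun π => π * π = 1 ∧ ∀ h, π h ≠ h

/-- The interaction-line factor over an arbitrary vertex type. -/
def lineFactor {V X : Type*} [DecidableEq X] (v : Matrix X X ℝ) (x : V × Fin 4 → X) (p : V) : ℝ :=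
  (-v (x (p, 0)) (x (p, 1))) * (if x (p, 0) = x (p, 2) then (1 : ℝ) else 0) *
    (if x (p, 1) = x (p, 3) then (1 : ℝ) else 0)

/-- Adjacency of interaction lines over an arbitrary vertex type. -/
def stepOn {V : Type*} (π : Equiv.Perm (V × Fin 4)) (p q : V) : Prop :=
  ∃ h : V × Fin 4, h.1 = p ∧ (π h).1 = q

/-- Connectedness over an arbitrary vertex type. -/
def ConnectedOn {V : Type*} (π : Equiv.Perm (V × Fin 4)) : Prop :=
  Nonempty V ∧ ∀ p q : V, Relation.ReflTransGen (stepOn π) p q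

/-- Transport of diagrams along a renaming of the vertices. -/
def reindexDiagram {V W : Type*} (f : V ≃ W) : Equiv.Perm (V × Fin 4) ≃ Equiv.Perm (W × Fin 4) :=
  (f.prodCongr (Equiv.refl (Fin 4))).permCongr

lemma reindexDiagram_apply {V W : Type*} (f : V ≃ W) (π : Equiv.Perm (V × Fin 4)) (h : V × Fin 4) :
    reindexDiagram f π (f h.1, h.2) = (f (π h).1, (π h).2) := by
  simp [reindexDiagram, Equiv.permCongr_apply, Prod.map]

@[simp] lemma reindexDiagram_symm_reindexDiagram {V W : Type*} (f : V ≃ W) (π : Equiv.Perm (V × Fin 4)) :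
    reindexDiagram f.symm (reindexDiagram f π) = π :=
  (reindexDiagram f).symm_apply_apply π

@[simp] lemma reindexDiagram_reindexDiagram_symm {V W : Type*} (f : V ≃ W) (π : Equiv.Perm (W × Fin 4)) :
    reindexDiagram f (reindexDiagram f.symm π) = π :=
  (reindexDiagram f).apply_symm_apply π

lemma ConnectedOn.reindexDiagram {V W : Type*} (f : V ≃ W) {π : Equiv.Perm (V × Fin 4)}
    (hπ : ConnectedOn π) : ConnectedOn (reindexDiagram f π) := by
  refine ⟨hπ.1.map f, f.surjective.forall₂.2 fun p q => ?_⟩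
  refine (hπ.2 p q).lift f ?_
  rintro _ _ ⟨h, rfl, rfl⟩
  exact ⟨(f h.1, h.2), rfl, by rw [reindexDiagram_apply]⟩

lemma connectedOn_reindexDiagram {V W : Type*} (f : V ≃ W) (π : Equiv.Perm (V × Fin 4)) :
    ConnectedOn (reindexDiagram f π) ↔ ConnectedOn π :=
  ⟨fun h => by simpa using h.reindexDiagram f.symm, fun h => h.reindexDiagram f⟩

variable {V W X : Type*} [DecidableEq V]

/-- Half-edges over `V` split into those over `S` and those over its complement. -/
def splitEquiv (S : Finset V) :
    ({p // p ∈ S} × Fin 4) ⊕ ({p // p ∉ S} × Fin 4) ≃ V × Fin 4 :=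
  (Equiv.sumProdDistrib _ _ _).symm.trans
    ((Equiv.sumCompl (· ∈ S)).prodCongr (Equiv.refl (Fin 4)))

@[simp] lemma splitEquiv_inl (S : Finset V) (h : {p // p ∈ S} × Fin 4) :
    splitEquiv S (Sum.inl h) = (h.1.1, h.2) := rfl

@[simp] lemma splitEquiv_inr (S : Finset V) (h : {p // p ∉ S} × Fin 4) :
    splitEquiv S (Sum.inr h) = (h.1.1, h.2) := rfl

/-- The disjoint union of a diagram over `S` and a diagram over its complement. -/
def glue (S : Finset V)
    (π : Equiv.Perm ({p // p ∈ S} × Fin 4) × Equiv.Perm ({p // p ∉ S} × Fin 4)) :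
    Equiv.Perm (V × Fin 4) :=
  (splitEquiv S).permCongr (Equiv.sumCongr π.1 π.2)

lemma glue_inl (S : Finset V)
    (π : Equiv.Perm ({p // p ∈ S} × Fin 4) × Equiv.Perm ({p // p ∉ S} × Fin 4))
    (h : {p // p ∈ S} × Fin 4) :
    glue S π (splitEquiv S (Sum.inl h)) = splitEquiv S (Sum.inl (π.1 h)) := by
  simp [glue, Equiv.permCongr_apply, -splitEquiv_inl]

lemma glue_inr (S : Finset V)
    (π : Equiv.Perm ({p // p ∈ S} × Fin 4) × Equiv.Perm ({p // p ∉ S} × Fin 4))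
    (h : {p // p ∉ S} × Fin 4) :
    glue S π (splitEquiv S (Sum.inr h)) = splitEquiv S (Sum.inr (π.2 h)) := by
  simp [glue, Equiv.permCongr_apply, -splitEquiv_inr]

lemma glue_injective (S : Finset V) : Function.Injective (glue S) := by
  intro a b hab
  exact Equiv.Perm.sumCongrHom_injective ((splitEquiv S).permCongr.injective hab)

lemma reachable_glue {S : Finset V}
    {π : Equiv.Perm ({p // p ∈ S} × Fin 4) × Equiv.Perm ({p // p ∉ S} × Fin 4)}
    (a : {p // p ∈ S}) (q : V) :
    Relation.ReflTransGen (stepOn (glue S π)) a q ↔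
      ∃ hq : q ∈ S, Relation.ReflTransGen (stepOn π.1) a ⟨q, hq⟩ := by
  constructor
  · intro h
    induction h with
    | refl => exact ⟨a.2, .refl⟩
    | tail _ hs ih =>
      obtain ⟨hb, ih⟩ := ih
      obtain ⟨⟨p, i⟩, rfl, rfl⟩ := hs
      have := glue_inl S π (⟨p, hb⟩, i)
      simp only [splitEquiv_inl] at this
      rw [this]
      exact ⟨(π.1 (⟨p, hb⟩, i)).1.2, ih.tail ⟨(⟨p, hb⟩, i), rfl, rfl⟩⟩
  · rintro ⟨hq, h⟩
    refine h.lift Subtype.val ?_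
    rintro _ _ ⟨h, rfl, rfl⟩
    exact ⟨splitEquiv S (Sum.inl h), rfl, by rw [glue_inl]; rfl⟩

variable [Fintype V] [Fintype W] [DecidableEq W] [Fintype X] [DecidableEq X]

lemma mem_diagramsOn {π : Equiv.Perm (V × Fin 4)} :
    π ∈ diagramsOn V ↔ (∀ h, π (π h) = h) ∧ ∀ h, π h ≠ h := by
  simp [diagramsOn, Equiv.ext_iff]

lemma reindexDiagram_mem_diagramsOn (f : V ≃ W) {π : Equiv.Perm (V × Fin 4)}
    (hπ : π ∈ diagramsOn V) : reindexDiagram f π ∈ diagramsOn W := by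
  obtain ⟨h1, h2⟩ := mem_diagramsOn.1 hπ
  refine mem_diagramsOn.2 ?_
  constructor <;> refine (f.prodCongr (Equiv.refl (Fin 4))).surjective.forall.2 fun h => ?_
  · exact (congrArg _ (reindexDiagram_apply f π h)).trans
      ((reindexDiagram_apply f π (π h)).trans (by rw [h1]; rfl))
  · refine fun hh => h2 h ((f.prodCongr (Equiv.refl (Fin 4))).injective ?_)
    exact (reindexDiagram_apply f π h).symm.trans hh

/-- The Feynman amplitude over an arbitrary vertex type, where `e` selects the first
half-edge of each pair. -/
def amplitudeOn (B v : Matrix X X ℝ) (e : V × Fin 4 → ℕ) (π : Equiv.Perm (V × Fin 4)) : ℝ :=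
  ∑ x : V × Fin 4 → X, (∏ p, lineFactor v x p) *
    ∏ h ∈ Finset.univ.filter (fun h => e h < e (π h)), B (x h) (x (π h))

/-- The total amplitude of all labeled diagrams. -/
def totalWeight (B v : Matrix X X ℝ) (e : V × Fin 4 → ℕ) : ℝ :=
  ∑ π ∈ diagramsOn V, amplitudeOn B v e π

open scoped Classical in
/-- The total amplitude of all connected labeled diagrams. -/
def connectedWeight (B v : Matrix X X ℝ) (e : V × Fin 4 → ℕ) : ℝ :=
  ∑ π ∈ diagramsOn V, if ConnectedOn π then amplitudeOn B v e π else 0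

lemma amplitudeOn_eq_of_injective {B v : Matrix X X ℝ} (hB : ∀ a b, B a b = B b a)
    {e e' : V × Fin 4 → ℕ} (he : e.Injective) (he' : e'.Injective)
    {π : Equiv.Perm (V × Fin 4)} (hπ : π ∈ diagramsOn V) :
    amplitudeOn B v e π = amplitudeOn B v e' π := by
  obtain ⟨h1, h2⟩ := mem_diagramsOn.1 hπ
  refine Finset.sum_congr rfl fun x _ => congrArg _ ?_
  have key : ∀ (e : V × Fin 4 → ℕ), e.Injective → ∀ h, ¬ e h < e (π h) → e (π h) < e h :=
    fun e he h hh => lt_of_le_of_ne (not_lt.1 hh) fun hh' => h2 h (he hh')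
  refine Finset.prod_bij' (fun h _ => if e' h < e' (π h) then h else π h)
    (fun h _ => if e h < e (π h) then h else π h) ?_ ?_ ?_ ?_ ?_
  · intro h hh
    have := key e' he' h
    split_ifs <;> simp_all
  · intro h hh
    have := key e he h
    split_ifs <;> simp_all
  · intro h hh
    have : e h < e (π h) := by simpa using hh
    split_ifs <;> simp_all; omega
  · intro h hh
    have : e' h < e' (π h) := by simpa using hh
    split_ifs <;> simp_all; omega
  · intro h hh
    split_ifs
    · rfl
    · rw [h1, hB]

lemma amplitudeOn_reindexDiagram (B v : Matrix X X ℝ) (f : V ≃ W) (e : W × Fin 4 → ℕ)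
    (π : Equiv.Perm (V × Fin 4)) :
    amplitudeOn B v e (reindexDiagram f π) = amplitudeOn B v (fun h => e (f h.1, h.2)) π := by
  unfold amplitudeOn
  simp only [Finset.prod_filter]
  let F : V × Fin 4 ≃ W × Fin 4 := f.prodCongr (Equiv.refl (Fin 4))
  rw [← (F.symm.arrowCongr (Equiv.refl X)).symm.sum_comp]
  refine Finset.sum_congr rfl fun x _ => ?_
  rw [← f.prod_comp, ← F.prod_comp]
  congr 1
  · simp [lineFactor, F]
  · refine Finset.prod_congr rfl fun h _ => ?_
    have : reindexDiagram f π (F h) = F (π h) := reindexDiagram_apply f π h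
    rw [this]
    simp [F, Prod.map]

lemma totalWeight_eq_of_equiv {B v : Matrix X X ℝ} (hB : ∀ a b, B a b = B b a) (f : V ≃ W)
    {e : V × Fin 4 → ℕ} {e' : W × Fin 4 → ℕ} (he : e.Injective) (he' : e'.Injective) :
    totalWeight B v e = totalWeight B v e' := by
  have hinj : Function.Injective fun h : V × Fin 4 => e' (f h.1, h.2) :=
    he'.comp (f.prodCongr (Equiv.refl (Fin 4))).injective
  refine Finset.sum_bij' (fun π _ => reindexDiagram f π) (fun π _ => reindexDiagram f.symm π)
    (fun π hπ => reindexDiagram_mem_diagramsOn f hπ) (fun π hπ => reindexDiagram_mem_diagramsOn f.symm hπ)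
    (fun π _ => by simp) (fun π _ => by simp) fun π hπ => ?_
  rw [amplitudeOn_reindexDiagram, amplitudeOn_eq_of_injective hB he hinj hπ]

lemma connectedWeight_eq_of_equiv {B v : Matrix X X ℝ} (hB : ∀ a b, B a b = B b a) (f : V ≃ W)
    {e : V × Fin 4 → ℕ} {e' : W × Fin 4 → ℕ} (he : e.Injective) (he' : e'.Injective) :
    connectedWeight B v e = connectedWeight B v e' := by
  have hinj : Function.Injective fun h : V × Fin 4 => e' (f h.1, h.2) :=
    he'.comp (f.prodCongr (Equiv.refl (Fin 4))).injective
  refine Finset.sum_bij' (fun π _ => reindexDiagram f π) (fun π _ => reindexDiagram f.symm π)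
    (fun π hπ => reindexDiagram_mem_diagramsOn f hπ) (fun π hπ => reindexDiagram_mem_diagramsOn f.symm hπ)
    (fun π _ => by simp) (fun π _ => by simp) fun π hπ => ?_
  rw [amplitudeOn_reindexDiagram, amplitudeOn_eq_of_injective hB he hinj hπ, connectedOn_reindexDiagram]

lemma glue_mem_diagramsOn (S : Finset V)
    (π : Equiv.Perm ({p // p ∈ S} × Fin 4) × Equiv.Perm ({p // p ∉ S} × Fin 4)) :
    glue S π ∈ diagramsOn V ↔
      π.1 ∈ diagramsOn {p // p ∈ S} ∧ π.2 ∈ diagramsOn {p // p ∉ S} := by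
  simp only [mem_diagramsOn, (splitEquiv S).surjective.forall, Sum.forall, glue_inl, glue_inr,
    ne_eq, EmbeddingLike.apply_eq_iff_eq, Sum.inl.injEq, Sum.inr.injEq]
  tauto

lemma amplitudeOn_glue (B v : Matrix X X ℝ) (S : Finset V) (e : V × Fin 4 → ℕ)
    (π : Equiv.Perm ({p // p ∈ S} × Fin 4) × Equiv.Perm ({p // p ∉ S} × Fin 4)) :
    amplitudeOn B v e (glue S π) = amplitudeOn B v (fun h => e (h.1.1, h.2)) π.1 *
      amplitudeOn B v (fun h => e (h.1.1, h.2)) π.2 := by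
  unfold amplitudeOn
  simp only [Finset.prod_filter]
  rw [Finset.sum_mul_sum, ← Finset.sum_product', Finset.univ_product_univ,
    ← (((splitEquiv S).symm.arrowCongr (Equiv.refl X)).trans
      (Equiv.sumArrowEquivProdArrow _ _ _)).symm.sum_comp]
  refine Finset.sum_congr rfl fun x _ => ?_
  set y := (((splitEquiv S).symm.arrowCongr (Equiv.refl X)).trans
      (Equiv.sumArrowEquivProdArrow _ _ _)).symm x with hy
  have hl : ∀ h, y (splitEquiv S (Sum.inl h)) = x.1 h := by
    intro h; simp [hy, -splitEquiv_inl]; rfl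
  have hr : ∀ h, y (splitEquiv S (Sum.inr h)) = x.2 h := by
    intro h; simp [hy, -splitEquiv_inr]; rfl
  rw [← (Equiv.sumCompl (· ∈ S)).prod_comp, ← (splitEquiv S).prod_comp, Fintype.prod_sum_type,
    Fintype.prod_sum_type]
  simp only [glue_inl, glue_inr, hl, hr]
  have h1 : ∀ p : {p // p ∈ S}, lineFactor v y (Equiv.sumCompl (· ∈ S) (Sum.inl p)) =
      lineFactor v x.1 p := by
    intro p
    simp only [lineFactor, ← hl]
    rfl
  have h2 : ∀ p : {p // p ∉ S}, lineFactor v y (Equiv.sumCompl (· ∈ S) (Sum.inr p)) =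
      lineFactor v x.2 p := by
    intro p
    simp only [lineFactor, ← hr]
    rfl
  simp only [h1, h2, splitEquiv_inl, splitEquiv_inr]
  rw [mul_mul_mul_comm]
  congr!

lemma stdSymm_stepOn {π : Equiv.Perm (V × Fin 4)} (hπ : π ∈ diagramsOn V) :
    Std.Symm (stepOn π) := by
  refine ⟨?_⟩
  rintro _ _ ⟨h, rfl, rfl⟩
  exact ⟨π h, rfl, by rw [(mem_diagramsOn.1 hπ).1]⟩

lemma exists_eq_glue {S : Finset V} {π : Equiv.Perm (V × Fin 4)}
    (hS : ∀ h : V × Fin 4, h.1 ∈ S → (π h).1 ∈ S) : ∃ ρ, π = glue S ρ := by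
  have : (splitEquiv S).permCongr.symm π ∈ (Equiv.Perm.sumCongrHom
      ({p // p ∈ S} × Fin 4) ({p // p ∉ S} × Fin 4)).range := by
    refine Equiv.Perm.mem_sumCongrHom_range_of_perm_mapsTo_inl ?_
    rintro _ ⟨h, rfl⟩
    refine ⟨(⟨_, hS (h.1.1, h.2) h.1.2⟩, (π (h.1.1, h.2)).2), ?_⟩
    apply (splitEquiv S).injective
    simp [Equiv.permCongr_apply]
  obtain ⟨ρ, hρ⟩ := this
  refine ⟨ρ, ?_⟩
  rw [Equiv.eq_symm_apply] at hρ
  exact hρ.symm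

open scoped Classical in
/-- The diagrams in which the connected component of `p` has vertex set `S` factor as a
connected diagram over `S` and an arbitrary diagram over the complement. -/
lemma sum_amplitudeOn_component (B v : Matrix X X ℝ) (e : V × Fin 4 → ℕ) (S : Finset V) (p : V)
    (hp : p ∈ S) :
    ∑ π ∈ diagramsOn V with ∀ q, Relation.ReflTransGen (stepOn π) p q ↔ q ∈ S,
        amplitudeOn B v e π =
      connectedWeight B v (fun h : {p // p ∈ S} × Fin 4 => e (h.1.1, h.2)) *
        totalWeight B v (fun h : {p // p ∉ S} × Fin 4 => e (h.1.1, h.2)) := by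
  rw [connectedWeight, totalWeight, ← Finset.sum_filter, Finset.sum_mul_sum,
    ← Finset.sum_product']
  symm
  refine Finset.sum_bij (fun ρ _ => glue S ρ) ?_ (fun _ _ _ _ h => glue_injective S h) ?_ ?_
  · intro ρ hρ
    simp only [Finset.mem_product, Finset.mem_filter] at hρ
    refine Finset.mem_filter.2 ⟨(glue_mem_diagramsOn S ρ).2 ⟨hρ.1.1, hρ.2⟩, fun q => ?_⟩
    rw [reachable_glue ⟨p, hp⟩]
    exact ⟨fun h => h.1, fun h => ⟨h, hρ.1.2.2 _ _⟩⟩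
  · intro π hπ
    obtain ⟨hπ, hc⟩ := Finset.mem_filter.1 hπ
    obtain ⟨ρ, rfl⟩ := exists_eq_glue (S := S) (π := π) fun h hh =>
      (hc _).1 (((hc _).2 hh).tail ⟨h, rfl, rfl⟩)
    obtain ⟨h1, h2⟩ := (glue_mem_diagramsOn S ρ).1 hπ
    have hr : ∀ q : {p // p ∈ S}, Relation.ReflTransGen (stepOn ρ.1) ⟨p, hp⟩ q := fun q =>
      ((reachable_glue ⟨p, hp⟩ q.1).1 ((hc q).2 q.2)).2
    refine ⟨ρ, ?_, rfl⟩
    simp only [Finset.mem_product, Finset.mem_filter]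
    have := stdSymm_stepOn h1
    exact ⟨⟨h1, ⟨⟨p, hp⟩⟩, fun a b => (symm (hr a)).trans (hr b)⟩, h2⟩
  · intro ρ _
    rw [amplitudeOn_glue]

lemma totalWeight_eq_sum_component (B v : Matrix X X ℝ) (e : V × Fin 4 → ℕ) (p : V) :
    totalWeight B v e = ∑ S : Finset V, if p ∈ S then
      connectedWeight B v (fun h : {p // p ∈ S} × Fin 4 => e (h.1.1, h.2)) *
        totalWeight B v (fun h : {p // p ∉ S} × Fin 4 => e (h.1.1, h.2)) else 0 := by
  classical
  rw [totalWeight, ← Finset.sum_fiberwise (diagramsOn V)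
    (fun π => Finset.univ.filter fun q => Relation.ReflTransGen (stepOn π) p q)]
  refine Finset.sum_congr rfl fun S _ => ?_
  simp only [Finset.ext_iff, Finset.mem_filter, Finset.mem_univ, true_and]
  split_ifs with hp
  · exact sum_amplitudeOn_component B v e S p hp
  · refine Finset.sum_eq_zero fun π hπ => ?_
    exact absurd (((Finset.mem_filter.1 hπ).2 p).1 .refl) hp

lemma card_mul_totalWeight (B v : Matrix X X ℝ) (e : V × Fin 4 → ℕ) :
    (Fintype.card V : ℝ) * totalWeight B v e = ∑ S : Finset V, (S.card : ℝ) *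
      (connectedWeight B v (fun h : {p // p ∈ S} × Fin 4 => e (h.1.1, h.2)) *
        totalWeight B v (fun h : {p // p ∉ S} × Fin 4 => e (h.1.1, h.2))) := by
  have := Finset.sum_congr rfl fun p (_ : p ∈ (Finset.univ : Finset V)) =>
    totalWeight_eq_sum_component B v e p
  rw [Finset.sum_const, Finset.card_univ, nsmul_eq_mul, Finset.sum_comm] at this
  rw [this]
  refine Finset.sum_congr rfl fun S _ => ?_
  rw [← Finset.sum_filter, Finset.sum_const, nsmul_eq_mul, Finset.filter_univ_mem]

end Diagrams

lemma henc_injective (n : ℕ) : Function.Injective (henc (n := n)) := by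
  rintro ⟨p, i⟩ ⟨q, j⟩ h
  simp only [henc] at h
  have := i.2
  have := j.2
  ext <;> simp only <;> omega

lemma mul_totalWeight_henc {X : Type*} [Fintype X] [DecidableEq X] {B v : Matrix X X ℝ}
    (hB : ∀ a b, B a b = B b a) (n : ℕ) :
    (n : ℝ) * totalWeight B v (henc (n := n)) = ∑ k ∈ Finset.range (n + 1),
      (n.choose k : ℝ) * (k * (connectedWeight B v (henc (n := k)) *
        totalWeight B v (henc (n := n - k)))) := by
  have h := card_mul_totalWeight B v (henc (n := n))
  rw [Fintype.card_fin] at h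
  have h2 := Finset.sum_powerset_apply_card (x := (Finset.univ : Finset (Fin n)))
    fun k => (k : ℝ) * (connectedWeight B v (henc (n := k)) *
        totalWeight B v (henc (n := n - k)))
  simp only [Finset.card_univ, Fintype.card_fin, nsmul_eq_mul, Finset.powerset_univ] at h2
  rw [h, ← h2]
  refine Finset.sum_congr rfl fun S _ => ?_
  have hl : Function.Injective fun h : {p // p ∈ S} × Fin 4 => henc (h.1.1, h.2) :=
    (henc_injective n).comp ((splitEquiv S).injective.comp Sum.inl_injective)
  have hr : Function.Injective fun h : {p // p ∉ S} × Fin 4 => henc (h.1.1, h.2) :=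
    (henc_injective n).comp ((splitEquiv S).injective.comp Sum.inr_injective)
  rw [connectedWeight_eq_of_equiv hB (Fintype.equivFinOfCardEq (by simp)) hl
      (henc_injective S.card),
    totalWeight_eq_of_equiv hB (Fintype.equivFinOfCardEq (n := n - S.card)
      (by simp [Fintype.card_subtype_compl])) hr (henc_injective (n - S.card))]

section Coefficients

variable {N : ℕ} (A v : Matrix (Fin N) (Fin N) ℝ)

lemma zCoeff_eq (n : ℕ) :
    zCoeff A v n = (1 / (8 ^ n * (n.factorial : ℝ))) * totalWeight A⁻¹ v (henc (n := n)) := rfl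

lemma cCoeff_eq (n : ℕ) : cCoeff A v n =
    (1 / (8 ^ n * (n.factorial : ℝ))) * connectedWeight A⁻¹ v (henc (n := n)) := by
  unfold cCoeff connectedWeight
  congr 1
  refine Finset.sum_congr rfl fun π _ => ?_
  have : IsConnectedDiagram π ↔ ConnectedOn π := by
    unfold IsConnectedDiagram ConnectedOn
    rw [← Fin.pos_iff_nonempty]
    rfl
  split_ifs <;> first | rfl | tauto

lemma zCoeff_zero : zCoeff A v 0 = 1 := by
  have h : closedDiagrams 0 = {1} := by
    ext π
    simp [closedDiagrams, Subsingleton.elim π 1]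
  simp [zCoeff, h, amplitude]

lemma cCoeff_zero : cCoeff A v 0 = 0 := by
  simp [cCoeff, IsConnectedDiagram]

variable {A v} in
lemma mul_zCoeff (hA : A.PosDef) (n : ℕ) :
    (n : ℝ) * zCoeff A v n =
      ∑ k ∈ Finset.range (n + 1), k * cCoeff A v k * zCoeff A v (n - k) := by
  have hB : ∀ a b, A⁻¹ a b = A⁻¹ b a := fun a b => by
    simpa using (hA.isHermitian.inv.apply a b).symm
  have h := mul_totalWeight_henc (v := v) hB n
  rw [zCoeff_eq, mul_left_comm, h, Finset.mul_sum]
  refine Finset.sum_congr rfl fun k hk => ?_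
  have hk : k ≤ n := by simpa [Nat.lt_succ_iff] using hk
  rw [zCoeff_eq, cCoeff_eq, Nat.cast_choose ℝ hk]
  have : (8 : ℝ) ^ n = 8 ^ k * 8 ^ (n - k) := by rw [← pow_add, Nat.add_sub_cancel' hk]
  rw [this]
  have := Nat.factorial_ne_zero n
  have := Nat.factorial_ne_zero k
  have := Nat.factorial_ne_zero (n - k)
  field_simp

end Coefficients

section Exponential

open PowerSeries

/-- The partial sums of the exponential series. -/
def expPartial (f : ℝ⟦X⟧) (M : ℕ) : ℝ⟦X⟧ :=
  ∑ K ∈ Finset.range (M + 1), (1 / (K.factorial : ℝ)) • f ^ K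

lemma derivative_expPartial_succ (f : ℝ⟦X⟧) (M : ℕ) :
    d⁄dX ℝ (expPartial f (M + 1)) = d⁄dX ℝ f * expPartial f M := by
  rw [expPartial, Finset.sum_range_succ', map_add, map_sum]
  simp only [expPartial, Finset.mul_sum]
  have : d⁄dX ℝ ((1 / (Nat.factorial 0 : ℝ)) • f ^ 0) = 0 := by simp
  rw [this, add_zero]
  refine Finset.sum_congr rfl fun K _ => ?_
  rw [Derivation.map_smul, derivative_pow, Nat.add_sub_cancel, mul_smul_comm, mul_assoc,
    ← nsmul_eq_mul, ← Nat.cast_smul_eq_nsmul ℝ, smul_smul, mul_comm (f ^ K)]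
  congr 1
  rw [Nat.factorial_succ]
  have := Nat.factorial_ne_zero K
  push_cast
  field_simp

lemma coeff_expPartial_of_le {f : ℝ⟦X⟧} (hf : constantCoeff f = 0) {n M : ℕ} (h : n ≤ M) :
    coeff n (expPartial f M) = coeff n (expPartial f n) := by
  simp only [expPartial, map_sum]
  symm
  refine Finset.sum_subset (Finset.range_subset_range.2 (by omega)) fun K _ hK => ?_
  have hK : n < K := by simpa using hK
  rw [coeff_smul, coeff_of_lt_order, smul_zero]
  exact lt_of_lt_of_le (by exact_mod_cast hK) (le_order_pow_of_constantCoeff_eq_zero K hf)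

lemma coeff_pow_eq_sum_antidiagonalTuple (f : ℝ⟦X⟧) (K n : ℕ) :
    coeff n (f ^ K) = ∑ m ∈ Finset.Nat.antidiagonalTuple K n, ∏ i, coeff (m i) f := by
  have := coeff_prod (fun _ : Fin K => f) n Finset.univ
  rw [Finset.prod_const, Finset.card_univ, Fintype.card_fin] at this
  rw [this]
  refine Finset.sum_bij' (fun m _ => ⇑m) (fun m _ => Finsupp.equivFunOnFinite.symm m)
    ?_ ?_ ?_ ?_ ?_ <;> simp [Finset.mem_finsuppAntidiag, Finset.Nat.mem_antidiagonalTuple]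

lemma succ_mul_coeff_expPartial {f : ℝ⟦X⟧} (hf : constantCoeff f = 0) (n : ℕ) :
    ((n + 1 : ℕ) : ℝ) * coeff (n + 1) (expPartial f (n + 1)) =
      ∑ k ∈ Finset.range (n + 1), ((k + 1 : ℕ) : ℝ) * coeff (k + 1) f *
        coeff (n - k) (expPartial f (n - k)) := by
  have h := congrArg (coeff n) (derivative_expPartial_succ f n)
  rw [coeff_derivative, coeff_mul, Finset.Nat.sum_antidiagonal_eq_sum_range_succ_mk] at h
  push_cast
  rw [mul_comm, h]
  refine Finset.sum_congr rfl fun k _ => ?_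
  rw [coeff_derivative, coeff_expPartial_of_le hf (Nat.sub_le n k)]
  ring

/-- A sequence satisfying the logarithmic-derivative recursion is given by the exponential
series. -/
lemma eq_coeff_expPartial {f : ℝ⟦X⟧} (hf : constantCoeff f = 0) {z : ℕ → ℝ} (h0 : z 0 = 1)
    (hz : ∀ n : ℕ, (n : ℝ) * z n = ∑ k ∈ Finset.range (n + 1), k * coeff k f * z (n - k))
    (n : ℕ) : z n = coeff n (expPartial f n) := by
  induction n using Nat.strong_induction_on with
  | _ n ih =>
    cases n with
    | zero => simp [h0, expPartial]
    | succ n =>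
      have hn : ((n + 1 : ℕ) : ℝ) ≠ 0 := by positivity
      refine mul_left_cancel₀ hn ?_
      rw [hz, succ_mul_coeff_expPartial hf, Finset.sum_range_succ']
      simp only [Nat.cast_zero, zero_mul, add_zero, Nat.add_sub_add_right]
      exact Finset.sum_congr rfl fun k _ => by rw [ih (n - k) (by omega)]

end Exponential

/-- **Linked cluster expansion**: `Σ_n z_n λ^n = exp(Σ_n c_n λ^n)` in `ℝ[[λ]]`,
stated coefficientwise: the `n`-th coefficient of `exp(Σ c_k λ^k)` is
`Σ_{K} (1/K!) Σ_{m₁+⋯+m_K = n} ∏ c_{m_i}`.  Equivalently, the asymptotic series of the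
free energy `Ω = −log Z` is `Ω₀ − Σ_{connected Γ} F_Γ/S_Γ`. -/
theorem linked_cluster_expansion {N : ℕ} (hN : 1 ≤ N) (A v : Matrix (Fin N) (Fin N) ℝ)
    (hA : A.PosDef) (hv : v.IsSymm) :
    ∀ n : ℕ, zCoeff A v n
      = ∑ K ∈ Finset.range (n + 1), (1 / (K.factorial : ℝ)) *
          ∑ m ∈ Finset.Nat.antidiagonalTuple K n, ∏ i, cCoeff A v (m i) := by
  intro n
  have hf : PowerSeries.constantCoeff (PowerSeries.mk (cCoeff A v)) = 0 := by
    rw [← PowerSeries.coeff_zero_eq_constantCoeff_apply, PowerSeries.coeff_mk, cCoeff_zero]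
  rw [eq_coeff_expPartial hf (zCoeff_zero A v)
    (by simpa only [PowerSeries.coeff_mk] using mul_zCoeff hA) n]
  simp only [expPartial, map_sum, PowerSeries.coeff_smul, coeff_pow_eq_sum_antidiagonalTuple,
    PowerSeries.coeff_mk, smul_eq_mul]
end
end

section
/- Skeleton decomposition. Every one-particle irreducible truncated Green's function diagram Γ can be written as a simultaneous insertion Γ = Γ_s ⊕_{(h₁^{(1)},h₂^{(1)},…,h₁^{(K)},h₂^{(K)})} [Γ^{(1)},…,Γ^{(K)}], where Γ_s is a two-particle irreducible (skeleton) diagram, the {h₁^{(k)},h₂^{(k)}} are K distinct 2-element orbits of Γ_s, and each Γ^{(k)} is a connected truncated Green's function diagram. Moreover this decomposition is unique up to, for each k separately, reversing the ordered pair (h₁^{(k)},h₂^{(k)}) while simultaneously exchanging the two external labels of Γ^{(k)}; and the Γ^{(k)} are precisely the maximal insertions admitted by Γ (ignoring the distinction of insertions by external labeling). -/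
noncomputable section

/-- A truncated Green's function diagram of order `n`: an involution of `H_n` whose only
fixed points are the two designated external half-edges (labeled `i` and `j`). -/
structure TruncDiagram (n : ℕ) where
  pairing : Equiv.Perm (HalfEdge n)
  involutive : pairing * pairing = 1
  ext₁ : HalfEdge n
  ext₂ : HalfEdge n
  ext_ne : ext₁ ≠ ext₂
  fix₁ : pairing ext₁ = ext₁
  fix₂ : pairing ext₂ = ext₂
  only_fix : ∀ h, pairing h = h → h = ext₁ ∨ h = ext₂

/-- Reachability between interaction lines via propagator lines avoiding the half-edges
in `S`. -/
def ReachAvoiding {n : ℕ} (π : Equiv.Perm (HalfEdge n)) (S : Set (HalfEdge n))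
    (p q : Fin n) : Prop :=
  Relation.ReflTransGen
    (fun u w => ∃ h, h ∉ S ∧ π h ∉ S ∧ π h ≠ h ∧ h.1 = u ∧ (π h).1 = w) p q

/-- One-particle irreducibility: connected, and unpairing any single 2-element orbit
leaves the diagram connected. -/
def Is1PI {n : ℕ} (Γ : TruncDiagram n) : Prop :=
  (∀ p q : Fin n, ReachAvoiding Γ.pairing ∅ p q) ∧
  ∀ h, Γ.pairing h ≠ h →
    ∀ p q : Fin n, ReachAvoiding Γ.pairing {h, Γ.pairing h} p q

/-- Reachability inside a vertex set `W` (connectivity of the subdiagram on `W`). -/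
def ReachWithin {n : ℕ} (π : Equiv.Perm (HalfEdge n)) (W : Set (Fin n))
    (p q : Fin n) : Prop :=
  Relation.ReflTransGen
    (fun u w => u ∈ W ∧ w ∈ W ∧ ∃ h : HalfEdge n, π h ≠ h ∧ h.1 = u ∧ (π h).1 = w) p q

/-- `Γ` admits a Green's function insertion with (nonempty) vertex set `W`, cut at the
ordered pair of half-edges `(a, b)`: the half-edges over `W` pair among themselves except
for the insertion's external half-edges `Γ.pairing a` (labeled `i`) and `Γ.pairing b`
(labeled `j`), which pair with the half-edges `a, b` lying outside `W`; moreover the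
subdiagram over `W` is connected.  Unpairing `{a, π a}` and `{b, π b}` thus disconnects
a nonempty connected truncated Green's function diagram with vertex set `W`. -/
def IsInsertion {n : ℕ} (Γ : TruncDiagram n) (W : Set (Fin n)) (a b : HalfEdge n) :
    Prop :=
  W.Nonempty ∧ a.1 ∉ W ∧ b.1 ∉ W ∧
  (Γ.pairing a).1 ∈ W ∧ (Γ.pairing b).1 ∈ W ∧ Γ.pairing a ≠ Γ.pairing b ∧
  (∀ h : HalfEdge n, h.1 ∈ W → h ≠ Γ.pairing a → h ≠ Γ.pairing b →
    Γ.pairing h ≠ h ∧ (Γ.pairing h).1 ∈ W) ∧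
  ∀ p q, p ∈ W → q ∈ W → ReachWithin Γ.pairing W p q

/-- A maximal insertion: a Green's function insertion not contained in any other
insertion. -/
def IsMaximalInsertion {n : ℕ} (Γ : TruncDiagram n) (W : Set (Fin n))
    (a b : HalfEdge n) : Prop :=
  IsInsertion Γ W a b ∧
    ∀ W' a' b', IsInsertion Γ W' a' b' → W ⊆ W' → W = W'

/-- One step of reachability in the skeleton obtained from `Γ` by collapsing the
insertions `𝔚 k` (cut at `(A k, B k)`) to single propagator lines: either an original
propagator line of `Γ` between skeleton vertices, or one of the `K` collapsed lines,
joining the vertices of `A k` and `B k`.  The half-edges in `EH` and the collapsed lines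
in `EK` are removed (unpaired). -/
def SkelStep {n K : ℕ} (Γ : TruncDiagram n) (𝔚 : Fin K → Set (Fin n))
    (A B : Fin K → HalfEdge n) (EH : Set (HalfEdge n)) (EK : Set (Fin K))
    (p q : Fin n) : Prop :=
  (∃ h : HalfEdge n, h ∉ EH ∧ Γ.pairing h ∉ EH ∧ Γ.pairing h ≠ h ∧
      h.1 = p ∧ (Γ.pairing h).1 = q ∧
      (∀ k, h.1 ∉ 𝔚 k) ∧ (∀ k, (Γ.pairing h).1 ∉ 𝔚 k)) ∨
  (∃ k, k ∉ EK ∧ (((A k).1 = p ∧ (B k).1 = q) ∨ ((B k).1 = p ∧ (A k).1 = q)))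

/-- All skeleton vertices are mutually reachable in the collapsed skeleton after
removing the half-edges `EH` and collapsed lines `EK`. -/
def SkelConn {n K : ℕ} (Γ : TruncDiagram n) (𝔚 : Fin K → Set (Fin n))
    (A B : Fin K → HalfEdge n) (EH : Set (HalfEdge n)) (EK : Set (Fin K)) : Prop :=
  ∀ p q : Fin n, (∀ k, p ∉ 𝔚 k) → (∀ k, q ∉ 𝔚 k) →
    Relation.ReflTransGen (SkelStep Γ 𝔚 A B EH EK) p q

/-- The collapsed skeleton is two-particle irreducible: it is connected, stays connected
after unpairing any single propagator line (original or collapsed), and stays connected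
after unpairing any two distinct propagator lines. -/
def SkelIs2PI {n K : ℕ} (Γ : TruncDiagram n) (𝔚 : Fin K → Set (Fin n))
    (A B : Fin K → HalfEdge n) : Prop :=
  SkelConn Γ 𝔚 A B ∅ ∅ ∧
  (∀ h, Γ.pairing h ≠ h → SkelConn Γ 𝔚 A B {h, Γ.pairing h} ∅) ∧
  (∀ k, SkelConn Γ 𝔚 A B ∅ {k}) ∧
  (∀ h h', Γ.pairing h ≠ h → Γ.pairing h' ≠ h' →
      ({h, Γ.pairing h} : Set (HalfEdge n)) ≠ {h', Γ.pairing h'} →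
      SkelConn Γ 𝔚 A B ({h, Γ.pairing h} ∪ {h', Γ.pairing h'}) ∅) ∧
  (∀ h k, Γ.pairing h ≠ h → SkelConn Γ 𝔚 A B {h, Γ.pairing h} {k}) ∧
  (∀ k k', k ≠ k' → SkelConn Γ 𝔚 A B ∅ ({k, k'} : Set (Fin K)))

/-- `Γ = Γ_s ⊕_{(A 1,B 1,…,A K,B K)} [Γ^{(1)},…,Γ^{(K)}]`: the `𝔚 k` are the vertex sets
of `K` pairwise disjoint Green's function insertions admitted by `Γ`, cut at the ordered
pairs `(A k, B k)` of skeleton half-edges, such that the skeleton obtained by collapsing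
each insertion to the propagator line `{A k, B k}` is a 2PI (skeleton) diagram. -/
def IsSkeletonDecomp {n : ℕ} (Γ : TruncDiagram n) (K : ℕ) (𝔚 : Fin K → Set (Fin n))
    (A B : Fin K → HalfEdge n) : Prop :=
  (∀ k, IsInsertion Γ (𝔚 k) (A k) (B k)) ∧
  (∀ k l, k ≠ l → Disjoint (𝔚 k) (𝔚 l)) ∧
  (∀ k l, (A k).1 ∉ 𝔚 l ∧ (B k).1 ∉ 𝔚 l) ∧
  SkelIs2PI Γ 𝔚 A B

theorem exists_crossing_step {α : Type*} {r : α → α → Prop} {p q : α} {S : Set α}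
    (h : Relation.ReflTransGen r p q) (hp : p ∈ S) (hq : q ∉ S) :
    ∃ u w, u ∈ S ∧ w ∉ S ∧ r u w := by
  induction h with
  | refl => exact absurd hp hq
  | @tail b c _ hbc ih =>
    by_cases hb : b ∈ S
    · exact ⟨b, c, hb, hq, hbc⟩
    · exact ih hb

namespace TruncDiagram

variable {n : ℕ} (Γ : TruncDiagram n)

@[simp]
theorem pairing_pairing (h : HalfEdge n) : Γ.pairing (Γ.pairing h) = h :=
  Equiv.ext_iff.mp Γ.involutive h

open Classical in
/-- The half-edges over `U` whose partners lie outside `U`. -/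
def boundary (U : Set (Fin n)) : Finset (HalfEdge n) :=
  Finset.univ.filter fun h => h.1 ∈ U ∧ (Γ.pairing h).1 ∉ U

variable {Γ} {U V W : Set (Fin n)} {a b h : HalfEdge n}

@[simp]
theorem mem_boundary : h ∈ Γ.boundary U ↔ h.1 ∈ U ∧ (Γ.pairing h).1 ∉ U := by
  simp [boundary]

theorem pairing_ne_of_mem_boundary (hh : h ∈ Γ.boundary U) : Γ.pairing h ≠ h := by
  intro e
  rw [mem_boundary, e] at hh
  exact hh.2 hh.1

theorem card_boundary_compl : (Γ.boundary Uᶜ).card = (Γ.boundary U).card := by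
  refine Finset.card_bij (fun h _ => Γ.pairing h) ?_ (fun _ _ _ _ e => Γ.pairing.injective e) ?_
  · intro h hh
    simp only [mem_boundary, Set.mem_compl_iff, not_not] at hh
    simp [hh.1, hh.2]
  · intro h hh
    rw [mem_boundary] at hh
    exact ⟨Γ.pairing h, by simp [hh.1, hh.2], by simp⟩

theorem card_boundary_inter_add_union_le :
    (Γ.boundary (U ∩ V)).card + (Γ.boundary (U ∪ V)).card ≤
      (Γ.boundary U).card + (Γ.boundary V).card := by
  classical
  simp only [boundary, Finset.card_filter, ← Finset.sum_add_distrib]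
  refine Finset.sum_le_sum fun h _ => ?_
  by_cases h₁ : h.1 ∈ U <;> by_cases h₂ : h.1 ∈ V <;>
    by_cases h₃ : (Γ.pairing h).1 ∈ U <;> by_cases h₄ : (Γ.pairing h).1 ∈ V <;>
    simp [h₁, h₂, h₃, h₄]

theorem card_boundary_le_two {x y : HalfEdge n}
    (hxy : ∀ h ∈ Γ.boundary U, (h = x ∨ h = Γ.pairing x) ∨ h = y ∨ h = Γ.pairing y) :
    (Γ.boundary U).card ≤ 2 := by
  classical
  have key : ∀ z : HalfEdge n,
      ((Γ.boundary U).filter fun h => h = z ∨ h = Γ.pairing z).card ≤ 1 := by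
    intro z
    rw [Finset.card_le_one]
    intro h hh h' hh'
    simp only [Finset.mem_filter, mem_boundary] at hh hh'
    obtain ⟨⟨h₁, h₂⟩, rfl | rfl⟩ := hh <;> obtain ⟨⟨h₃, h₄⟩, rfl | rfl⟩ := hh' <;> simp_all
  refine (Finset.card_le_card (t := ((Γ.boundary U).filter fun h => h = x ∨ h = Γ.pairing x) ∪
    (Γ.boundary U).filter fun h => h = y ∨ h = Γ.pairing y) fun h hh => ?_).trans
    ((Finset.card_union_le _ _).trans (add_le_add (key x) (key y)))
  rw [Finset.mem_union, Finset.mem_filter, Finset.mem_filter, ← and_or_left]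
  exact ⟨hh, hxy h hh⟩

/-- Vertices are four-valent, so a boundary of even size does not separate the external
half-edges. -/
theorem ext_mem_iff_of_even (hU : Even (Γ.boundary U).card) :
    Γ.ext₁.1 ∈ U ↔ Γ.ext₂.1 ∈ U := by
  classical
  let I : Finset (HalfEdge n) := Finset.univ.filter fun h =>
    h.1 ∈ U ∧ (Γ.pairing h).1 ∈ U ∧ Γ.pairing h ≠ h
  let E : Finset (HalfEdge n) := {Γ.ext₁, Γ.ext₂}
  let F : Finset (HalfEdge n) := E.filter fun h => h.1 ∈ U
  let H : Finset (HalfEdge n) := Finset.univ.filter fun h => h.1 ∈ U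
  have hI : (I.card : ZMod 2) = 0 := by
    rw [Finset.cast_card]
    refine Finset.sum_involution (fun h _ => Γ.pairing h) (fun _ _ => by decide) ?_ ?_ ?_
    · intro h hh _
      exact (Finset.mem_filter.mp hh).2.2.2
    · intro h hh
      simp only [I, Finset.mem_filter, Finset.mem_univ, true_and] at hh ⊢
      refine ⟨hh.2.1, by simpa using hh.1, fun e => hh.2.2 ?_⟩
      exact Γ.pairing.injective e
    · intro h _
      exact Γ.pairing_pairing h
  have hH : (H.card : ZMod 2) = 0 := by
    have : H = (Finset.univ.filter fun v => v ∈ U) ×ˢ (Finset.univ : Finset (Fin 4)) := by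
      ext h
      simp [H]
    rw [this, Finset.card_product, Nat.cast_mul]
    have h4 : ((Finset.univ : Finset (Fin 4)).card : ZMod 2) = 0 := by decide
    rw [h4, mul_zero]
  have hdecomp : H = (Γ.boundary U ∪ I) ∪ F := by
    ext h
    have := Γ.only_fix h
    have h₁ := Γ.fix₁
    have h₂ := Γ.fix₂
    simp only [H, I, F, E, Finset.mem_filter, Finset.mem_univ, true_and, Finset.mem_union,
      mem_boundary, Finset.mem_insert, Finset.mem_singleton]
    tauto
  have hd₁ : Disjoint (Γ.boundary U) I := by
    rw [Finset.disjoint_left]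
    intro h hh hh'
    exact (mem_boundary.mp hh).2 (Finset.mem_filter.mp hh').2.2.1
  have hd₂ : Disjoint (Γ.boundary U ∪ I) F := by
    rw [Finset.disjoint_left]
    intro h hh hh'
    have hfix : Γ.pairing h = h := by
      have := (Finset.mem_filter.mp hh').1
      simp only [E, Finset.mem_insert, Finset.mem_singleton] at this
      rcases this with rfl | rfl
      · exact Γ.fix₁
      · exact Γ.fix₂
    rcases Finset.mem_union.mp hh with hb | hi
    · exact pairing_ne_of_mem_boundary hb hfix
    · exact (Finset.mem_filter.mp hi).2.2.2 hfix
  have hF : (F.card : ZMod 2) = 0 := by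
    rw [hdecomp, Finset.card_union_of_disjoint hd₂, Finset.card_union_of_disjoint hd₁] at hH
    push_cast at hH
    rwa [hI, (ZMod.natCast_eq_zero_iff_even).mpr hU, zero_add, zero_add] at hH
  have hne := Γ.ext_ne
  by_cases h₁ : Γ.ext₁.1 ∈ U <;> by_cases h₂ : Γ.ext₂.1 ∈ U <;>
    simp [F, E, Finset.filter_insert, Finset.filter_singleton, h₁, h₂] at hF ⊢

/-- The vertex sets of insertions of a 1PI diagram, described by their boundary. -/
def IsInsertionSet (Γ : TruncDiagram n) (W : Set (Fin n)) : Prop :=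
  W.Nonempty ∧ Γ.ext₁.1 ∉ W ∧ Γ.ext₂.1 ∉ W ∧ (Γ.boundary W).card = 2

end TruncDiagram

open TruncDiagram

section Insertion

variable {n : ℕ} {Γ : TruncDiagram n} {U V W : Set (Fin n)} {a b a' b' h : HalfEdge n}

theorem Is1PI.two_le_card_boundary (hΓ : Is1PI Γ) (hU : U.Nonempty) (hU' : Uᶜ.Nonempty) :
    2 ≤ (Γ.boundary U).card := by
  obtain ⟨p, hp⟩ := hU
  obtain ⟨q, hq⟩ := hU'
  obtain ⟨_, _, hu, hw, x, _, _, hx, rfl, rfl⟩ := exists_crossing_step (hΓ.1 p q) hp hq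
  obtain ⟨_, _, hu', hw', y, hy, -, -, rfl, rfl⟩ :=
    exists_crossing_step (hΓ.2 x hx p q) hp hq
  have hxy : x ≠ y := fun e => hy (by simp [e])
  exact Finset.one_lt_card.mpr
    ⟨x, mem_boundary.mpr ⟨hu, hw⟩, y, mem_boundary.mpr ⟨hu', hw'⟩, hxy⟩

theorem IsInsertion.swap (hW : IsInsertion Γ W a b) : IsInsertion Γ W b a := by
  obtain ⟨h₁, h₂, h₃, h₄, h₅, h₆, h₇, h₈⟩ := hW
  exact ⟨h₁, h₃, h₂, h₅, h₄, h₆.symm, fun h hh hb ha => h₇ h hh ha hb, h₈⟩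

theorem IsInsertion.mem_boundary_iff (hW : IsInsertion Γ W a b) :
    h ∈ Γ.boundary W ↔ h = Γ.pairing a ∨ h = Γ.pairing b := by
  obtain ⟨-, h₂, h₃, h₄, h₅, -, h₇, -⟩ := hW
  rw [mem_boundary]
  constructor
  · rintro ⟨hh, hh'⟩
    by_contra! hc
    exact hh' (h₇ h hh hc.1 hc.2).2
  · rintro (rfl | rfl)
    · simp [h₂, h₄]
    · simp [h₃, h₅]

theorem IsInsertion.eq_or_eq_of_pairing_mem (hW : IsInsertion Γ W a b) (hh : h.1 ∉ W)
    (hh' : (Γ.pairing h).1 ∈ W) : h = a ∨ h = b := by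
  have : Γ.pairing h ∈ Γ.boundary W := by simp [hh, hh']
  simpa using hW.mem_boundary_iff.mp this

theorem IsInsertion.ends_unique (hW : IsInsertion Γ W a b) (hW' : IsInsertion Γ W a' b') :
    (a' = a ∧ b' = b) ∨ (a' = b ∧ b' = a) := by
  have ha := hW.eq_or_eq_of_pairing_mem hW'.2.1 hW'.2.2.2.1
  have hb := hW.eq_or_eq_of_pairing_mem hW'.2.2.1 hW'.2.2.2.2.1
  have hne : a' ≠ b' := fun e => hW'.2.2.2.2.2.1 (by rw [e])
  rcases ha with rfl | rfl <;> rcases hb with rfl | rfl <;> simp_all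

theorem IsInsertion.isInsertionSet (hW : IsInsertion Γ W a b) : Γ.IsInsertionSet W := by
  classical
  have key : ∀ e : HalfEdge n, Γ.pairing e = e → e.1 ∉ W := by
    intro e he hm
    obtain ⟨-, h₂, h₃, h₄, h₅, -, h₇, -⟩ := hW
    refine (h₇ e hm ?_ ?_).1 he
    · intro hc
      have := Γ.pairing.injective (he.trans hc)
      exact h₂ (this ▸ hm)
    · intro hc
      have := Γ.pairing.injective (he.trans hc)
      exact h₃ (this ▸ hm)
  refine ⟨hW.1, key _ Γ.fix₁, key _ Γ.fix₂, Finset.card_eq_two.mpr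
    ⟨Γ.pairing a, Γ.pairing b, hW.2.2.2.2.2.1, ?_⟩⟩
  ext h
  simp [hW.mem_boundary_iff, -mem_boundary]

theorem TruncDiagram.IsInsertionSet.exists_isInsertion (hΓ : Is1PI Γ)
    (hW : Γ.IsInsertionSet W) : ∃ a b, IsInsertion Γ W a b := by
  classical
  obtain ⟨hne, h₁, h₂, hcard⟩ := hW
  obtain ⟨x, y, hxy, hB⟩ := Finset.card_eq_two.mp hcard
  have hmem : ∀ h, h.1 ∈ W ∧ (Γ.pairing h).1 ∉ W ↔ h = x ∨ h = y := by
    intro h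
    rw [← mem_boundary, hB]
    simp
  have hx := (hmem x).mpr (Or.inl rfl)
  have hy := (hmem y).mpr (Or.inr rfl)
  refine ⟨Γ.pairing x, Γ.pairing y, hne, hx.2, hy.2, by simpa using hx.1, by simpa using hy.1,
    by simpa using hxy, ?_, ?_⟩
  · intro h hh hhx hhy
    rw [pairing_pairing] at hhx hhy
    refine ⟨fun e => ?_, ?_⟩
    · rcases Γ.only_fix h e with rfl | rfl
      · exact h₁ hh
      · exact h₂ hh
    · by_contra hc
      rcases (hmem h).mp ⟨hh, hc⟩ with e | e
      · exact hhx e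
      · exact hhy e
  · intro p q hp hq
    by_contra hpq
    let C : Set (Fin n) := {v | v ∈ W ∧ ReachWithin Γ.pairing W p v}
    have hC : ∀ h : HalfEdge n, h.1 ∈ W → (Γ.pairing h).1 ∈ W → h.1 ∈ C →
        (Γ.pairing h).1 ∈ C := by
      intro h hh hh' hc
      refine ⟨hh', ?_⟩
      by_cases e : Γ.pairing h = h
      · rw [e]
        exact hc.2
      · exact hc.2.tail ⟨hh, hh', h, e, rfl, rfl⟩
    have hd : Disjoint (Γ.boundary C) (Γ.boundary (W \ C)) := by
      rw [Finset.disjoint_left]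
      intro h hh hh'
      exact (mem_boundary.mp hh').1.2 (mem_boundary.mp hh).1
    have hsub : Γ.boundary C ∪ Γ.boundary (W \ C) ⊆ Γ.boundary W := by
      intro h hh
      rw [Finset.mem_union, mem_boundary, mem_boundary] at hh
      rw [mem_boundary]
      rcases hh with ⟨hh, hh'⟩ | ⟨hh, hh'⟩
      · exact ⟨hh.1, fun hc => hh' (hC h hh.1 hc hh)⟩
      · refine ⟨hh.1, fun hc => hh' ⟨hc, fun hc' => hh.2 ?_⟩⟩
        simpa using hC (Γ.pairing h) hc (by simpa using hh.1) hc'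
    have hle := Finset.card_le_card hsub
    rw [Finset.card_union_of_disjoint hd, hcard] at hle
    have hC2 := hΓ.two_le_card_boundary (U := C) ⟨p, hp, .refl⟩ ⟨q, fun hc => hpq hc.2⟩
    have hD2 := hΓ.two_le_card_boundary (U := W \ C) ⟨q, hq, fun hc => hpq hc.2⟩
      ⟨Γ.ext₁.1, fun hc => h₁ hc.1⟩
    omega

theorem TruncDiagram.IsInsertionSet.union (hΓ : Is1PI Γ) (hU : Γ.IsInsertionSet U)
    (hV : Γ.IsInsertionSet V) (hUV : (U ∩ V).Nonempty) : Γ.IsInsertionSet (U ∪ V) := by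
  obtain ⟨hU₀, hU₁, hU₂, hU₃⟩ := hU
  obtain ⟨-, hV₁, hV₂, hV₃⟩ := hV
  have hne : (U ∪ V).Nonempty := hU₀.inl
  have h₁ : Γ.ext₁.1 ∉ U ∪ V := by simp [hU₁, hV₁]
  refine ⟨hne, h₁, by simp [hU₂, hV₂], ?_⟩
  have hi := hΓ.two_le_card_boundary hUV ⟨Γ.ext₁.1, fun hc => hU₁ hc.1⟩
  have hu := hΓ.two_le_card_boundary hne ⟨Γ.ext₁.1, h₁⟩
  have := card_boundary_inter_add_union_le (Γ := Γ) (U := U) (V := V)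
  omega

theorem TruncDiagram.IsInsertionSet.union_of_adj (hΓ : Is1PI Γ) (hU : Γ.IsInsertionSet U)
    (hV : Γ.IsInsertionSet V) (hUV : Disjoint U V) (hh : h.1 ∈ U)
    (hh' : (Γ.pairing h).1 ∈ V) : Γ.IsInsertionSet (U ∪ V) := by
  classical
  obtain ⟨hU₀, hU₁, hU₂, hU₃⟩ := hU
  obtain ⟨-, hV₁, hV₂, hV₃⟩ := hV
  have hne : (U ∪ V).Nonempty := hU₀.inl
  have h₁ : Γ.ext₁.1 ∉ U ∪ V := by simp [hU₁, hV₁]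
  refine ⟨hne, h₁, by simp [hU₂, hV₂], ?_⟩
  have hu := hΓ.two_le_card_boundary hne ⟨Γ.ext₁.1, h₁⟩
  have hhU : h ∈ Γ.boundary U := mem_boundary.mpr ⟨hh, hUV.notMem_of_mem_right hh'⟩
  have hhV : Γ.pairing h ∈ Γ.boundary V :=
    mem_boundary.mpr ⟨hh', by simpa using hUV.notMem_of_mem_left hh⟩
  have hsub : Γ.boundary (U ∪ V) ⊆
      (Γ.boundary U).erase h ∪ (Γ.boundary V).erase (Γ.pairing h) := by
    intro g hg
    simp only [mem_boundary, Set.mem_union, not_or] at hg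
    simp only [Finset.mem_union, Finset.mem_erase, mem_boundary]
    refine hg.1.imp (fun hgU => ⟨?_, hgU, hg.2.1⟩) fun hgV => ⟨?_, hgV, hg.2.2⟩
    · rintro rfl
      exact hg.2.2 hh'
    · rintro rfl
      exact hg.2.1 (by simpa using hh)
  have hle := (Finset.card_le_card hsub).trans (Finset.card_union_le _ _)
  rw [Finset.card_erase_of_mem hhU, Finset.card_erase_of_mem hhV, hU₃, hV₃] at hle
  omega

/-- An insertion set separating the two ends of another insertion has a boundary half-edge
on a propagator line touching that insertion. -/
theorem IsInsertion.exists_mem_boundary (hV : IsInsertion Γ V a b) (ha : a.1 ∈ W)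
    (hb : b.1 ∉ W) : ∃ z ∈ Γ.boundary W, z.1 ∈ V ∨ (Γ.pairing z).1 ∈ V := by
  obtain ⟨-, -, -, h₄, h₅, -, -, h₈⟩ := hV
  by_cases ha' : (Γ.pairing a).1 ∈ W
  · by_cases hb' : (Γ.pairing b).1 ∈ W
    · exact ⟨Γ.pairing b, by simp [hb, hb'], Or.inl h₅⟩
    · obtain ⟨_, _, hu, hw, huV, -, z, -, rfl, rfl⟩ :=
        exists_crossing_step (h₈ _ _ h₄ h₅) ha' hb'
      exact ⟨z, mem_boundary.mpr ⟨hu, hw⟩, Or.inl huV⟩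
  · exact ⟨a, mem_boundary.mpr ⟨ha, ha'⟩, Or.inr h₄⟩

end Insertion

section Skeleton

variable {n K : ℕ} {Γ : TruncDiagram n} {𝔚 : Fin K → Set (Fin n)} {A B : Fin K → HalfEdge n}

theorem skelConn_of_removed_lines (hΓ : Is1PI Γ)
    (hins : ∀ k, IsInsertion Γ (𝔚 k) (A k) (B k))
    (hout : ∀ k l, (A k).1 ∉ 𝔚 l ∧ (B k).1 ∉ 𝔚 l)
    (hmax : ∀ W, Γ.IsInsertionSet W → ∃ k, W ⊆ 𝔚 k)
    {EH : Set (HalfEdge n)} {EK : Set (Fin K)} (x y : HalfEdge n)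
    (hEH : EH ⊆ {x, Γ.pairing x} ∪ {y, Γ.pairing y})
    (hEK : ∀ k ∈ EK, B k = x ∨ B k = y) : SkelConn Γ 𝔚 A B EH EK := by
  intro p q hp hq
  by_contra hpq
  let C : Set (Fin n) :=
    {v | (∀ k, v ∉ 𝔚 k) ∧ Relation.ReflTransGen (SkelStep Γ 𝔚 A B EH EK) p v}
  let U : Set (Fin n) := {v | v ∈ C ∨ ∃ k, (A k).1 ∈ C ∧ v ∈ 𝔚 k}
  have hpU : p ∈ U := Or.inl ⟨hp, .refl⟩
  have hqU : q ∉ U := by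
    rintro (hc | ⟨k, -, hk⟩)
    · exact hpq hc.2
    · exact hq k hk
  have hcross : ∀ k, (A k).1 ∈ C → (B k).1 ∉ C → k ∈ EK := by
    intro k hA hB
    by_contra hk
    exact hB ⟨fun l => (hout k l).2, hA.2.tail (Or.inr ⟨k, hk, Or.inl ⟨rfl, rfl⟩⟩)⟩
  have hcross' : ∀ k, (B k).1 ∈ C → (A k).1 ∉ C → k ∈ EK := by
    intro k hB hA
    by_contra hk
    exact hA ⟨fun l => (hout k l).1, hB.2.tail (Or.inr ⟨k, hk, Or.inr ⟨rfl, rfl⟩⟩)⟩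
  have hle : (Γ.boundary U).card ≤ 2 := by
    refine card_boundary_le_two (x := x) (y := y) fun h hh => ?_
    have hne := pairing_ne_of_mem_boundary hh
    obtain ⟨hh₁, hh₂⟩ := mem_boundary.mp hh
    rcases hh₁ with hC | ⟨k, hA, hk⟩
    · by_cases hskel : ∀ k, (Γ.pairing h).1 ∉ 𝔚 k
      · have hmem : h ∈ EH ∨ Γ.pairing h ∈ EH := by
          by_contra! hc
          exact hh₂ (Or.inl ⟨hskel, hC.2.tail
            (Or.inl ⟨h, hc.1, hc.2, hne, rfl, rfl, hC.1, hskel⟩)⟩)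
        rcases hmem with hm | hm
        · exact hEH hm
        · rcases hEH hm with (e | e) | (e | e)
          · simp [← e]
          · simp [Γ.pairing.injective e]
          · simp [← e]
          · simp [Γ.pairing.injective e]
      · push Not at hskel
        obtain ⟨k, hk⟩ := hskel
        rcases (hins k).eq_or_eq_of_pairing_mem (hC.1 k) hk with rfl | rfl
        · exact absurd (Or.inr ⟨k, hC, hk⟩) hh₂
        · have hA : (A k).1 ∉ C := fun hA => hh₂ (Or.inr ⟨k, hA, hk⟩)
          rcases hEK k (hcross' k hC hA) with e | e <;> simp [e]
    · have hb : h ∈ Γ.boundary (𝔚 k) :=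
        mem_boundary.mpr ⟨hk, fun hc => hh₂ (Or.inr ⟨k, hA, hc⟩)⟩
      rcases (hins k).mem_boundary_iff.mp hb with rfl | rfl
      · rw [pairing_pairing] at hh₂
        exact absurd (Or.inl hA) hh₂
      · rw [pairing_pairing] at hh₂
        rcases hEK k (hcross k hA fun hB => hh₂ (Or.inl hB)) with e | e <;> simp [e]
  have hcard : (Γ.boundary U).card = 2 :=
    le_antisymm hle (hΓ.two_le_card_boundary ⟨p, hpU⟩ ⟨q, hqU⟩)
  have hext : Γ.ext₁.1 ∈ U ↔ Γ.ext₂.1 ∈ U := ext_mem_iff_of_even (hcard ▸ even_two)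
  by_cases h₁ : Γ.ext₁.1 ∈ U
  · obtain ⟨k, hk⟩ := hmax Uᶜ ⟨⟨q, hqU⟩, not_not.mpr h₁, not_not.mpr (hext.mp h₁),
      card_boundary_compl.trans hcard⟩
    exact hq k (hk hqU)
  · obtain ⟨k, hk⟩ := hmax U ⟨⟨p, hpU⟩, h₁, fun hc => h₁ (hext.mpr hc), hcard⟩
    exact hp k (hk hpU)

theorem skelIs2PI_of_maximal (hΓ : Is1PI Γ)
    (hins : ∀ k, IsInsertion Γ (𝔚 k) (A k) (B k))
    (hout : ∀ k l, (A k).1 ∉ 𝔚 l ∧ (B k).1 ∉ 𝔚 l)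
    (hmax : ∀ W, Γ.IsInsertionSet W → ∃ k, W ⊆ 𝔚 k) : SkelIs2PI Γ 𝔚 A B := by
  have key := @skelConn_of_removed_lines n K Γ 𝔚 A B hΓ hins hout hmax
  refine ⟨?_, fun h _ => ?_, fun k => ?_, fun h h' _ _ _ => ?_, fun h k _ => ?_,
    fun k k' _ => ?_⟩
  · exact key Γ.ext₁ Γ.ext₁ (by simp) (by simp)
  · exact key h h (by simp) (by simp)
  · exact key (B k) (B k) (by simp) (by simp)
  · exact key h h' subset_rfl (by simp)
  · exact key h (B k) Set.subset_union_left (by simp)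
  · exact key (B k) (B k') (by simp) (by simp)

theorem exists_isSkeletonDecomp (hΓ : Is1PI Γ) :
    ∃ (K : ℕ) (𝔚 : Fin K → Set (Fin n)) (A B : Fin K → HalfEdge n),
      IsSkeletonDecomp Γ K 𝔚 A B := by
  obtain ⟨K, ⟨e⟩⟩ := Finite.exists_equiv_fin {W : Set (Fin n) // Maximal Γ.IsInsertionSet W}
  let 𝔚 : Fin K → Set (Fin n) := fun k => (e.symm k).1
  have hM : ∀ k, Maximal Γ.IsInsertionSet (𝔚 k) := fun k => (e.symm k).2
  choose A B hins using fun k => (hM k).prop.exists_isInsertion hΓ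
  have hinj : ∀ k l, 𝔚 k = 𝔚 l → k = l := fun k l h => e.symm.injective (Subtype.ext h)
  have hunion : ∀ k l, Γ.IsInsertionSet (𝔚 k ∪ 𝔚 l) → k = l := by
    intro k l h
    have h₁ := (hM k).eq_of_subset h Set.subset_union_left
    have h₂ := (hM l).eq_of_subset h Set.subset_union_right
    exact hinj k l (h₁.trans h₂.symm)
  have hdisj : ∀ k l, k ≠ l → Disjoint (𝔚 k) (𝔚 l) := by
    intro k l hkl
    by_contra hd
    exact hkl (hunion k l ((hM k).prop.union hΓ (hM l).prop
      (Set.not_disjoint_iff_nonempty_inter.mp hd)))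
  have hadj : ∀ k l h, h.1 ∉ 𝔚 k → (Γ.pairing h).1 ∈ 𝔚 k → h.1 ∉ 𝔚 l := by
    intro k l h hh hh' hl
    have hlk : l ≠ k := by
      rintro rfl
      exact hh hl
    exact hlk (hunion l k ((hM l).prop.union_of_adj hΓ (hM k).prop (hdisj l k hlk) hl hh'))
  have hout : ∀ k l, (A k).1 ∉ 𝔚 l ∧ (B k).1 ∉ 𝔚 l := fun k l =>
    ⟨hadj k l _ (hins k).2.1 (hins k).2.2.2.1, hadj k l _ (hins k).2.2.1 (hins k).2.2.2.2.1⟩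
  refine ⟨K, 𝔚, A, B, hins, hdisj, hout, skelIs2PI_of_maximal hΓ hins hout fun W hW => ?_⟩
  obtain ⟨M, hWM, hMmax⟩ := Finite.exists_le_maximal hW
  exact ⟨e ⟨M, hMmax⟩, by simpa [𝔚] using hWM⟩

theorem IsSkeletonDecomp.touching_unique (hD : IsSkeletonDecomp Γ K 𝔚 A B) {z : HalfEdge n}
    {k l : Fin K} (hk : z.1 ∈ 𝔚 k ∨ (Γ.pairing z).1 ∈ 𝔚 k)
    (hl : z.1 ∈ 𝔚 l ∨ (Γ.pairing z).1 ∈ 𝔚 l) : k = l := by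
  obtain ⟨hins, hdisj, hout, -⟩ := hD
  have key : ∀ k l : Fin K, ∀ z : HalfEdge n, z.1 ∈ 𝔚 k → (Γ.pairing z).1 ∈ 𝔚 l → k = l := by
    intro k l z hk hl
    by_contra hkl
    rcases (hins l).eq_or_eq_of_pairing_mem ((hdisj k l hkl).notMem_of_mem_left hk) hl
      with rfl | rfl
    · exact (hout l k).1 hk
    · exact (hout l k).2 hk
  have key' : ∀ v : Fin n, v ∈ 𝔚 k → v ∈ 𝔚 l → k = l := by
    intro v hk hl
    by_contra hkl
    exact (hdisj k l hkl).notMem_of_mem_left hk hl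
  rcases hk with hk | hk <;> rcases hl with hl | hl
  · exact key' _ hk hl
  · exact key k l z hk hl
  · exact (key l k z hl hk).symm
  · exact key' _ hk hl

theorem IsSkeletonDecomp.not_skelConn (hD : IsSkeletonDecomp Γ K 𝔚 A B) {W : Set (Fin n)}
    (hW : Γ.IsInsertionSet W) {p : Fin n} (hpW : p ∈ W) (hp : ∀ k, p ∉ 𝔚 k)
    {EH : Set (HalfEdge n)} {EK : Set (Fin K)}
    (hEH : ∀ z ∈ Γ.boundary W, z ∈ EH ∨ ∃ k, z.1 ∈ 𝔚 k ∨ (Γ.pairing z).1 ∈ 𝔚 k)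
    (hEK : ∀ z ∈ Γ.boundary W, ∀ k, z.1 ∈ 𝔚 k ∨ (Γ.pairing z).1 ∈ 𝔚 k → k ∈ EK) :
    ¬ SkelConn Γ 𝔚 A B EH EK := by
  intro hconn
  have hext : ∀ k, Γ.ext₁.1 ∉ 𝔚 k := fun k => (hD.1 k).isInsertionSet.2.1
  obtain ⟨_, _, hu, hw, ⟨h, hh, -, -, rfl, rfl, hs, ht⟩ |
      ⟨k, hk, ⟨rfl, rfl⟩ | ⟨rfl, rfl⟩⟩⟩ :=
    exists_crossing_step (hconn p Γ.ext₁.1 hp hext) hpW hW.2.1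
  · rcases hEH h (mem_boundary.mpr ⟨hu, hw⟩) with hm | ⟨k, hm | hm⟩
    · exact hh hm
    · exact hs k hm
    · exact ht k hm
  · obtain ⟨z, hz, hzk⟩ := (hD.1 k).exists_mem_boundary hu hw
    exact hk (hEK z hz k hzk)
  · obtain ⟨z, hz, hzk⟩ := (hD.1 k).swap.exists_mem_boundary hu hw
    exact hk (hEK z hz k hzk)

theorem IsSkeletonDecomp.exists_mem (hD : IsSkeletonDecomp Γ K 𝔚 A B) {W : Set (Fin n)}
    (hW : Γ.IsInsertionSet W) {p : Fin n} (hpW : p ∈ W) : ∃ k, p ∈ 𝔚 k := by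
  by_contra! hp
  obtain ⟨x, y, hxy, hB⟩ := Finset.card_eq_two.mp hW.2.2.2
  have hmem : ∀ z, z ∈ Γ.boundary W ↔ z = x ∨ z = y := fun z => by rw [hB]; simp
  have hx := (hmem x).mpr (Or.inl rfl)
  have hy := (hmem y).mpr (Or.inr rfl)
  have not_conn := @IsSkeletonDecomp.not_skelConn n K Γ 𝔚 A B hD W hW p hpW hp
  simp only [hmem, forall_eq_or_imp, forall_eq] at not_conn
  obtain ⟨-, c₂, c₃, c₄, c₅⟩ := hD.2.2.2.2
  by_cases tx : ∃ k, x.1 ∈ 𝔚 k ∨ (Γ.pairing x).1 ∈ 𝔚 k <;>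
    by_cases ty : ∃ k, y.1 ∈ 𝔚 k ∨ (Γ.pairing y).1 ∈ 𝔚 k
  · have ⟨k, hk⟩ := tx
    have ⟨l, hl⟩ := ty
    by_cases hkl : k = l
    · subst hkl
      exact not_conn ⟨Or.inr tx, Or.inr ty⟩
        ⟨fun m hm => hD.touching_unique hm hk, fun m hm => hD.touching_unique hm hl⟩ (c₂ k)
    · exact not_conn ⟨Or.inr tx, Or.inr ty⟩
        ⟨fun m hm => Or.inl (hD.touching_unique hm hk),
          fun m hm => Or.inr (hD.touching_unique hm hl)⟩ (c₅ k l hkl)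
  · have ⟨k, hk⟩ := tx
    exact not_conn ⟨Or.inr tx, Or.inl (Or.inl rfl)⟩
      ⟨fun m hm => hD.touching_unique hm hk, fun m hm => absurd ⟨m, hm⟩ ty⟩
      (c₄ y k (pairing_ne_of_mem_boundary hy))
  · have ⟨l, hl⟩ := ty
    exact not_conn ⟨Or.inl (Or.inl rfl), Or.inr ty⟩
      ⟨fun m hm => absurd ⟨m, hm⟩ tx, fun m hm => hD.touching_unique hm hl⟩
      (c₄ x l (pairing_ne_of_mem_boundary hx))
  · refine not_conn ⟨Or.inl (Or.inl (Or.inl rfl)), Or.inl (Or.inr (Or.inl rfl))⟩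
      ⟨fun m hm => absurd ⟨m, hm⟩ tx, fun m hm => absurd ⟨m, hm⟩ ty⟩
      (c₃ x y (pairing_ne_of_mem_boundary hx) (pairing_ne_of_mem_boundary hy) fun e => ?_)
    have hmx : x ∈ ({y, Γ.pairing y} : Set (HalfEdge n)) := e ▸ Or.inl rfl
    rcases hmx with e' | e'
    · exact hxy e'
    · rw [mem_boundary] at hx hy
      exact hy.2 (e' ▸ hx.1)

theorem IsSkeletonDecomp.exists_subset (hD : IsSkeletonDecomp Γ K 𝔚 A B) {W : Set (Fin n)}
    {a b : HalfEdge n} (hW : IsInsertion Γ W a b) : ∃ k, W ⊆ 𝔚 k := by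
  obtain ⟨p, hp⟩ := hW.1
  obtain ⟨k, hk⟩ := hD.exists_mem hW.isInsertionSet hp
  refine ⟨k, fun q hq => ?_⟩
  by_contra hqk
  obtain ⟨_, _, hu, hw, -, hwW, h, -, rfl, rfl⟩ :=
    exists_crossing_step (hW.2.2.2.2.2.2.2 p q hp hq) hk hqk
  obtain ⟨l, hl⟩ := hD.exists_mem hW.isInsertionSet hwW
  obtain rfl := hD.touching_unique (z := h) (Or.inl hu) (Or.inr hl)
  exact hw hl

theorem IsSkeletonDecomp.isMaximalInsertion_iff (hD : IsSkeletonDecomp Γ K 𝔚 A B)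
    {W : Set (Fin n)} {a b : HalfEdge n} :
    IsMaximalInsertion Γ W a b ↔
      ∃ k, W = 𝔚 k ∧ ((a = A k ∧ b = B k) ∨ (a = B k ∧ b = A k)) := by
  constructor
  · rintro ⟨hW, hmax⟩
    obtain ⟨k, hk⟩ := hD.exists_subset hW
    obtain rfl := hmax _ _ _ (hD.1 k) hk
    exact ⟨k, rfl, (hD.1 k).ends_unique hW⟩
  · rintro ⟨k, rfl, hab⟩
    refine ⟨?_, fun W' a' b' hW' hsub => hsub.antisymm ?_⟩
    · rcases hab with ⟨rfl, rfl⟩ | ⟨rfl, rfl⟩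
      · exact hD.1 k
      · exact (hD.1 k).swap
    · obtain ⟨l, hl⟩ := hD.exists_subset hW'
      obtain ⟨p, hp⟩ := (hD.1 k).1
      have hkl : k = l := hD.touching_unique (z := (p, 0)) (Or.inl hp) (Or.inl (hl (hsub hp)))
      exact hkl ▸ hl

theorem IsSkeletonDecomp.injective (hD : IsSkeletonDecomp Γ K 𝔚 A B) :
    Function.Injective 𝔚 := by
  intro k l h
  obtain ⟨p, hp⟩ := (hD.1 k).1
  exact hD.touching_unique (z := (p, 0)) (Or.inl hp) (Or.inl (h ▸ hp))

theorem IsSkeletonDecomp.exists_eq {K' : ℕ} {𝔚' : Fin K' → Set (Fin n)}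
    {A' B' : Fin K' → HalfEdge n} (hD : IsSkeletonDecomp Γ K 𝔚 A B)
    (hD' : IsSkeletonDecomp Γ K' 𝔚' A' B') (k : Fin K') :
    ∃ l, 𝔚' k = 𝔚 l ∧ ((A' k = A l ∧ B' k = B l) ∨ (A' k = B l ∧ B' k = A l)) :=
  hD.isMaximalInsertion_iff.mp
    (hD'.isMaximalInsertion_iff.mpr ⟨k, rfl, Or.inl ⟨rfl, rfl⟩⟩)

theorem IsSkeletonDecomp.unique {K' : ℕ} {𝔚' : Fin K' → Set (Fin n)}
    {A' B' : Fin K' → HalfEdge n} (hD : IsSkeletonDecomp Γ K 𝔚 A B)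
    (hD' : IsSkeletonDecomp Γ K' 𝔚' A' B') :
    ∃ σ : Fin K' ≃ Fin K, ∀ k, 𝔚' k = 𝔚 (σ k) ∧
      ((A' k = A (σ k) ∧ B' k = B (σ k)) ∨ (A' k = B (σ k) ∧ B' k = A (σ k))) := by
  choose f hf using hD.exists_eq hD'
  choose g hg using hD'.exists_eq hD
  exact ⟨⟨f, g, fun k => hD'.injective ((hg (f k)).1.symm.trans (hf k).1.symm),
    fun k => hD.injective ((hf (g k)).1.symm.trans (hg k).1.symm)⟩, hf⟩

end Skeleton

/-- **Skeleton decomposition**: every 1PI truncated Green's function diagram `Γ` can be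
written as a 2PI skeleton diagram with connected truncated Green's function diagrams
inserted along `K` of its propagator lines; this decomposition is unique up to, for each
`k` separately, reversing the ordered pair `(A k, B k)` (i.e. exchanging the external
labels of the `k`-th insertion); and the insertions of any such decomposition are
precisely the maximal insertions admitted by `Γ` (ignoring the distinction of insertions
by external labeling). -/
theorem skeleton_decomposition {n : ℕ} (hn : 1 ≤ n) (Γ : TruncDiagram n)
    (hΓ : Is1PI Γ) :
    (∃ (K : ℕ) (𝔚 : Fin K → Set (Fin n)) (A B : Fin K → HalfEdge n),
      IsSkeletonDecomp Γ K 𝔚 A B) ∧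
    (∀ (K : ℕ) (𝔚 : Fin K → Set (Fin n)) (A B : Fin K → HalfEdge n)
        (K' : ℕ) (𝔚' : Fin K' → Set (Fin n)) (A' B' : Fin K' → HalfEdge n),
      IsSkeletonDecomp Γ K 𝔚 A B → IsSkeletonDecomp Γ K' 𝔚' A' B' →
      ∃ σ : Fin K' ≃ Fin K, ∀ k, 𝔚' k = 𝔚 (σ k) ∧
        ((A' k = A (σ k) ∧ B' k = B (σ k)) ∨ (A' k = B (σ k) ∧ B' k = A (σ k)))) ∧
    (∀ (K : ℕ) (𝔚 : Fin K → Set (Fin n)) (A B : Fin K → HalfEdge n),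
      IsSkeletonDecomp Γ K 𝔚 A B →
      ∀ (W : Set (Fin n)) (a b : HalfEdge n),
        IsMaximalInsertion Γ W a b ↔
          ∃ k, W = 𝔚 k ∧
            ((a = A k ∧ b = B k) ∨ (a = B k ∧ b = A k))) := by
  exact ⟨exists_isSkeletonDecomp hΓ, fun _ _ _ _ _ _ _ _ hD hD' => hD.unique hD',
    fun _ _ _ _ hD _ _ _ => hD.isMaximalInsertion_iff⟩
end
end

section
/- First- and second-order Luttinger–Ward identities. Let G and v be real symmetric N×N matrices. Define Σ^{(1)}[G,v]_{ij} = −(1/2)(Σ_k v_{ik} G_{kk}) δ_{ij} − v_{ij} G_{ij}, Σ^{(2)}[G,v]_{ij} = (1/2) G_{ij} Σ_{k,l} v_{ik} G_{kl}² v_{lj} + Σ_{k,l} v_{ik} G_{kj} G_{kl} G_{li} v_{jl}, Φ^{(1)}[G,v] = −(1/4) Σ_{i,j} v_{ij} G_{ii} G_{jj} − (1/2) Σ_{i,j} v_{ij} G_{ij}², and Φ^{(2)}[G,v] = (1/8) Σ_{i,j,k,l} G_{ij}² v_{ik} G_{kl}² v_{lj} + (1/4) Σ_{i,j,k,l} v_{ik}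 v_{jl} G_{ij} G_{kj} G_{kl} G_{li}. Then Φ^{(1)}[G,v] = (1/2)·Tr(G Σ^{(1)}[G,v]) and Φ^{(2)}[G,v] = (1/4)·Tr(G Σ^{(2)}[G,v]); i.e., Φ^{(k)} = (1/2k)·Tr(G Σ^{(k)}) for k = 1, 2. -/
open Matrix

noncomputable section

/-- The first-order (Hartree–Fock) bold self-energy
`Σ^{(1)}[G,v]_{ij} = −(1/2)(Σ_k v_{ik} G_{kk}) δ_{ij} − v_{ij} G_{ij}`. -/
def Sigma1 {N : ℕ} (G v : Matrix (Fin N) (Fin N) ℝ) : Matrix (Fin N) (Fin N) ℝ :=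
  Matrix.of fun i j =>
    -(1 / 2) * (∑ k, v i k * G k k) * (if i = j then (1 : ℝ) else 0) - v i j * G i j

/-- The second-order (GF2) bold self-energy
`Σ^{(2)}[G,v]_{ij} = (1/2) G_{ij} Σ_{k,l} v_{ik} G_{kl}² v_{lj}
  + Σ_{k,l} v_{ik} G_{kj} G_{kl} G_{li} v_{jl}`. -/
def Sigma2 {N : ℕ} (G v : Matrix (Fin N) (Fin N) ℝ) : Matrix (Fin N) (Fin N) ℝ :=
  Matrix.of fun i j =>
    (1 / 2) * G i j * (∑ k, ∑ l, v i k * G k l ^ 2 * v l j) +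
      ∑ k, ∑ l, v i k * G k j * G k l * G l i * v j l

/-- The first-order Luttinger–Ward contribution
`Φ^{(1)}[G,v] = −(1/4) Σ v_{ij} G_{ii} G_{jj} − (1/2) Σ v_{ij} G_{ij}²`. -/
def Phi1 {N : ℕ} (G v : Matrix (Fin N) (Fin N) ℝ) : ℝ :=
  -(1 / 4) * (∑ i, ∑ j, v i j * G i i * G j j) - (1 / 2) * ∑ i, ∑ j, v i j * G i j ^ 2

/-- The second-order Luttinger–Ward contribution
`Φ^{(2)}[G,v] = (1/8) Σ G_{ij}² v_{ik} G_{kl}² v_{lj}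
  + (1/4) Σ v_{ik} v_{jl} G_{ij} G_{kj} G_{kl} G_{li}`. -/
def Phi2 {N : ℕ} (G v : Matrix (Fin N) (Fin N) ℝ) : ℝ :=
  (1 / 8) * (∑ i, ∑ j, ∑ k, ∑ l, G i j ^ 2 * v i k * G k l ^ 2 * v l j) +
    (1 / 4) * ∑ i, ∑ j, ∑ k, ∑ l, v i k * v j l * G i j * G k j * G k l * G l i

theorem trace_mul_eq_sum_of_isSymm {n R : Type*} [Fintype n] [NonUnitalNonAssocSemiring R]
    {G : Matrix n n R} (hG : G.IsSymm) (A : Matrix n n R) :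
    (G * A).trace = ∑ i, ∑ j, G i j * A i j := by
  simp only [Matrix.trace, Matrix.diag_apply, Matrix.mul_apply]
  rw [Finset.sum_comm]
  simp only [hG.apply]

/-- **First- and second-order Luttinger–Ward identities**:
`Φ^{(k)}[G,v] = (1/(2k))·Tr(G Σ^{(k)}[G,v])` for `k = 1, 2`. -/
theorem luttinger_ward_identities {N : ℕ} (G v : Matrix (Fin N) (Fin N) ℝ)
    (hG : G.IsSymm) (hv : v.IsSymm) :
    Phi1 G v = (1 / 2) * (G * Sigma1 G v).trace ∧
    Phi2 G v = (1 / 4) * (G * Sigma2 G v).trace := by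
  rw [trace_mul_eq_sum_of_isSymm hG, trace_mul_eq_sum_of_isSymm hG]
  constructor
  · have hterm (i : Fin N) : ∑ j, G i j * Sigma1 G v i j =
        -(1 / 2) * ∑ j, v i j * G i i * G j j - ∑ j, v i j * G i j ^ 2 := by
      simp only [Sigma1, Matrix.of_apply, mul_sub, Finset.sum_sub_distrib, mul_ite, mul_one,
        mul_zero, Finset.sum_ite_eq, Finset.mem_univ, if_true, Finset.mul_sum]
      congr 1 <;> exact Finset.sum_congr rfl fun j _ => by ring
    simp only [hterm, Phi1, Finset.sum_sub_distrib, ← Finset.mul_sum]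
    ring
  · simp only [Phi2, Sigma2, Matrix.of_apply, Finset.mul_sum, mul_add, Finset.sum_add_distrib]
    congr 1 <;>
      exact Finset.sum_congr rfl fun i _ => Finset.sum_congr rfl fun j _ =>
        Finset.sum_congr rfl fun k _ => Finset.sum_congr rfl fun l _ => by ring
end
end

section
/- Φ-derivability of the first- and second-order approximations. Let G, v, H be real symmetric N×N matrices. With Σ^{(1)}, Σ^{(2)}, Φ^{(1)}, Φ^{(2)} defined by Σ^{(1)}[G,v]_{ij} = −(1/2)(Σ_k v_{ik} G_{kk}) δ_{ij} − v_{ij} G_{ij}; Σ^{(2)}[G,v]_{ij} = (1/2) G_{ij} Σ_{k,l} v_{ik} G_{kl}² v_{lj} + Σ_{k,l} v_{ik} G_{kj} G_{kl} G_{li} v_{jl}; Φ^{(1)}[G,v] = −(1/4) Σ v_{ij} G_{ii} G_{jj} − (1/2) Σ v_{ij} G_{ij}²; Φ^{(2)}[G,v] = (1/8) Σ G_{ij}² v_{ik} G_{kl}² v_{lj} + (1/4) Σ v_{ik} v_{jl} G_{ij} G_{kj} G_{kl} G_{li}, one has (d/dt) Φ^{(1)}[G + tH, v] |_{t=0} =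 Tr( Σ^{(1)}[G,v] · H ) and (d/dt) Φ^{(2)}[G + tH, v] |_{t=0} = Tr( Σ^{(2)}[G,v] · H ). -/
open Matrix

noncomputable section

lemma sum_swap_first_third {ι : Type*} [Fintype ι] (f : ι → ι → ι → ι → ℝ) :
    ∑ i, ∑ j, ∑ k, ∑ l, f k j i l = ∑ i, ∑ j, ∑ k, ∑ l, f i j k l := by
  rw [Finset.sum_comm]
  conv_rhs => rw [Finset.sum_comm]
  exact Finset.sum_congr rfl fun j _ => Finset.sum_comm

lemma sum_swap_second_fourth {ι : Type*} [Fintype ι] (f : ι → ι → ι → ι → ℝ) :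
    ∑ i, ∑ j, ∑ k, ∑ l, f i l k j = ∑ i, ∑ j, ∑ k, ∑ l, f i j k l := by
  refine Finset.sum_congr rfl fun i _ => ?_
  rw [Finset.sum_comm]
  conv_rhs => rw [Finset.sum_comm]
  exact Finset.sum_congr rfl fun k _ => Finset.sum_comm

lemma hasDerivAt_entry {N : ℕ} (G H : Matrix (Fin N) (Fin N) ℝ) (i j : Fin N) :
    HasDerivAt (fun t : ℝ => (G + t • H) i j) (H i j) 0 := by
  simpa using ((hasDerivAt_id (0 : ℝ)).mul_const (H i j)).const_add (G i j)

lemma hasDerivAt_Phi1 {N : ℕ} (G v H : Matrix (Fin N) (Fin N) ℝ)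
    (hv : v.IsSymm) (hH : H.IsSymm) :
    HasDerivAt (fun t : ℝ => Phi1 (G + t • H) v) ((Sigma1 G v * H).trace) 0 := by
  have e := hasDerivAt_entry G H
  have hartree := HasDerivAt.fun_sum (u := Finset.univ) fun i _ =>
    HasDerivAt.fun_sum (u := Finset.univ) fun j _ =>
      ((e i i).const_mul (v i j)).fun_mul (e j j)
  have fock := HasDerivAt.fun_sum (u := Finset.univ) fun i _ =>
    HasDerivAt.fun_sum (u := Finset.univ) fun j _ => ((e i j).fun_pow 2).const_mul (v i j)
  refine ((hartree.const_mul (-(1 / 4))).fun_sub (fock.const_mul (1 / 2))).congr_deriv ?_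
  have swap : ∑ i, ∑ j, v i j * G i i * H j j = ∑ i, ∑ j, v i j * H i i * G j j := by
    rw [Finset.sum_comm]
    refine Finset.sum_congr rfl fun i _ => Finset.sum_congr rfl fun j _ => ?_
    rw [hv.apply]
    ring
  have trace_eq : (Sigma1 G v * H).trace =
      -(1 / 2) * (∑ i, ∑ j, v i j * H i i * G j j) - ∑ i, ∑ j, v i j * G i j * H i j := by
    simp only [trace, diag_apply, mul_apply, Sigma1, of_apply, sub_mul, Finset.sum_sub_distrib,
      hH.apply]
    congr 1
    simp only [mul_ite, mul_one, mul_zero, ite_mul, zero_mul, Finset.sum_ite_eq,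
      Finset.mem_univ, if_true, Finset.mul_sum, Finset.sum_mul]
    refine Finset.sum_congr rfl fun i _ => Finset.sum_congr rfl fun j _ => ?_
    ring
  have fock_eq : ∑ i, ∑ j, v i j * (2 * G i j * H i j) = 2 * ∑ i, ∑ j, v i j * G i j * H i j := by
    simp only [Finset.mul_sum]
    refine Finset.sum_congr rfl fun i _ => Finset.sum_congr rfl fun j _ => ?_
    ring
  rw [trace_eq]
  simp only [zero_smul, add_zero, Nat.cast_ofNat, Nat.add_one_sub_one, pow_one,
    Finset.sum_add_distrib, swap, fock_eq]
  ring

lemma hasDerivAt_Phi2 {N : ℕ} (G v H : Matrix (Fin N) (Fin N) ℝ)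
    (hG : G.IsSymm) (hv : v.IsSymm) (hH : H.IsSymm) :
    HasDerivAt (fun t : ℝ => Phi2 (G + t • H) v) ((Sigma2 G v * H).trace) 0 := by
  have e := hasDerivAt_entry G H
  have ring_diagram := HasDerivAt.fun_sum (u := Finset.univ) fun i _ =>
    HasDerivAt.fun_sum (u := Finset.univ) fun j _ =>
      HasDerivAt.fun_sum (u := Finset.univ) fun k _ =>
        HasDerivAt.fun_sum (u := Finset.univ) fun l _ =>
          ((((e i j).fun_pow 2).mul_const (v i k)).fun_mul ((e k l).fun_pow 2)).mul_const (v l j)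
  have exchange := HasDerivAt.fun_sum (u := Finset.univ) fun i _ =>
    HasDerivAt.fun_sum (u := Finset.univ) fun j _ =>
      HasDerivAt.fun_sum (u := Finset.univ) fun k _ =>
        HasDerivAt.fun_sum (u := Finset.univ) fun l _ =>
          ((((e i j).const_mul (v i k * v j l)).fun_mul (e k j)).fun_mul (e k l)).fun_mul (e l i)
  refine ((ring_diagram.const_mul (1 / 8)).fun_add (exchange.const_mul (1 / 4))).congr_deriv ?_
  let R : Fin N → Fin N → Fin N → Fin N → ℝ := fun i j k l =>
    G i j * H i j * v i k * G k l ^ 2 * v l j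
  let X : Fin N → Fin N → Fin N → Fin N → ℝ := fun i j k l =>
    v i k * v j l * H i j * G k j * G k l * G l i
  have trace_eq : (Sigma2 G v * H).trace =
      (1 / 2) * (∑ i, ∑ j, ∑ k, ∑ l, R i j k l) + ∑ i, ∑ j, ∑ k, ∑ l, X i j k l := by
    simp only [trace, diag_apply, mul_apply, Sigma2, of_apply, hH.apply,
      Finset.mul_sum, Finset.sum_mul, add_mul, ← Finset.sum_add_distrib, R, X]
    refine Finset.sum_congr rfl fun i _ => Finset.sum_congr rfl fun j _ =>
      Finset.sum_congr rfl fun k _ => Finset.sum_congr rfl fun l _ => ?_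
    ring
  have hR : ∑ i, ∑ j, ∑ k, ∑ l, R k l i j = ∑ i, ∑ j, ∑ k, ∑ l, R i j k l :=
    (sum_swap_first_third fun i j k l => R i l k j).trans (sum_swap_second_fourth R)
  have hX : ∑ i, ∑ j, ∑ k, ∑ l, X k l i j = ∑ i, ∑ j, ∑ k, ∑ l, X i j k l :=
    (sum_swap_first_third fun i j k l => X i l k j).trans (sum_swap_second_fourth X)
  calc
    _ = (1 / 8) * (∑ i, ∑ j, ∑ k, ∑ l, (2 * R i j k l + 2 * R k l i j)) +
        (1 / 4) * ∑ i, ∑ j, ∑ k, ∑ l, (X i j k l + X k j i l + X k l i j + X i l k j) := by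
      simp only [zero_smul, add_zero, Nat.cast_ofNat, Nat.add_one_sub_one, pow_one]
      refine congrArg₂ (· + ·) (congrArg _ ?_) (congrArg _ ?_) <;>
      · refine Finset.sum_congr rfl fun i _ => Finset.sum_congr rfl fun j _ =>
          Finset.sum_congr rfl fun k _ => Finset.sum_congr rfl fun l _ => ?_
        simp only [R, X, hv.apply i k, hv.apply j l, hG.apply i j, hG.apply j k, hG.apply k l,
          hG.apply i l, hH.apply i l]
        ring
    _ = _ := by
      rw [trace_eq]
      simp only [Finset.sum_add_distrib, ← Finset.mul_sum, hR, hX, sum_swap_first_third X,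
        sum_swap_second_fourth X]
      ring

/-- **Φ-derivability of the first- and second-order approximations**: the derivative of
`t ↦ Φ^{(k)}[G + tH, v]` at `t = 0` in any symmetric direction `H` is
`Tr(Σ^{(k)}[G,v]·H)`, for `k = 1, 2`. -/
theorem phi_derivability {N : ℕ} (G v H : Matrix (Fin N) (Fin N) ℝ)
    (hG : G.IsSymm) (hv : v.IsSymm) (hH : H.IsSymm) :
    HasDerivAt (fun t : ℝ => Phi1 (G + t • H) v) ((Sigma1 G v * H).trace) 0 ∧
    HasDerivAt (fun t : ℝ => Phi2 (G + t • H) v) ((Sigma2 G v * H).trace) 0 := by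
  exact ⟨hasDerivAt_Phi1 G v H hv hH, hasDerivAt_Phi2 G v H hG hv hH⟩
end
end

section
/- Φ-derivability of the GW approximation. Let G and v be real symmetric N×N matrices with v invertible, and suppose det(I + (1/2) v (G⊙G)) ≠ 0, where ⊙ denotes the entrywise (Hadamard) product. Let W = (v⁻¹ + (1/2) G⊙G)⁻¹ (so that W = (I + (1/2) v(G⊙G))⁻¹ v, and W is symmetric). Then for every real symmetric N×N matrix H, (d/dt) det( I + (1/2) v ((G+tH)⊙(G+tH)) ) |_{t=0} = det( I + (1/2) v (G⊙G) ) · Tr( (G⊙W) H ). In particular, wherever det(I + (1/2) v(G⊙G)) > 0, the directional derivative of Φ(G) := Tr log(I + (1/2) v(G⊙G)) = log det(I + (1/2) v(G⊙G)) in the symmetric direction H equals Tr((G⊙W)H), so the screened-exchange term G⊙W of the GW self-energy is the matrix derivative of −Φ. -/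
open Matrix

noncomputable section

/-- The screened Coulomb interaction `W[G,v] = (v⁻¹ + (1/2) G⊙G)⁻¹`. -/
def screenedW {N : ℕ} (G v : Matrix (Fin N) (Fin N) ℝ) : Matrix (Fin N) (Fin N) ℝ :=
  (v⁻¹ + (1 / 2 : ℝ) • hadamard G G)⁻¹

/-- **Jacobi's formula**, along a curve of matrices with differentiable entries. -/
theorem hasDerivAt_det {n 𝕜 : Type*} [Fintype n] [DecidableEq n] [NontriviallyNormedField 𝕜]
    {M : 𝕜 → Matrix n n 𝕜} {M' : Matrix n n 𝕜} {t : 𝕜}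
    (h : ∀ i j, HasDerivAt (fun s => M s i j) (M' i j) t) :
    HasDerivAt (fun s => (M s).det) ((M t).adjugate * M').trace t := by
  have htrace : ((M t).adjugate * M').trace =
      ∑ σ : Equiv.Perm n, (Equiv.Perm.sign σ : 𝕜) *
        ∑ j, (∏ i ∈ Finset.univ.erase j, M t (σ i) i) * M' (σ j) j := by
    have hcol (j : n) : ((M t).adjugate * M') j j =
        ∑ σ : Equiv.Perm n, (Equiv.Perm.sign σ : 𝕜) *
          ((∏ i ∈ Finset.univ.erase j, M t (σ i) i) * M' (σ j) j) := by
      have hcramer : ((M t).adjugate * M') j j = ((M t).updateCol j fun i => M' i j).det := by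
        rw [← cramer_apply, cramer_eq_adjugate_mulVec]
        rfl
      rw [hcramer, det_apply']
      refine Finset.sum_congr rfl fun σ _ => ?_
      rw [← Finset.prod_erase_mul _ _ (Finset.mem_univ j), updateCol_self]
      congr 2
      exact Finset.prod_congr rfl fun i hi => updateCol_ne (Finset.ne_of_mem_erase hi)
    simp only [trace, diag_apply, hcol, Finset.mul_sum]
    exact Finset.sum_comm
  rw [htrace]
  simp only [det_apply']
  exact HasDerivAt.fun_sum fun σ _ =>
    (HasDerivAt.fun_finsetProd fun i _ => h (σ i) i).const_mul _

/-- Hadamard multiplication by a symmetric matrix is self-adjoint for the trace pairing. -/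
theorem trace_mul_hadamard_of_isSymm {n R : Type*} [Fintype n] [CommSemiring R]
    {G : Matrix n n R} (hG : G.IsSymm) (W H : Matrix n n R) :
    (W * hadamard G H).trace = (hadamard G W * H).trace := by
  simp only [trace, diag_apply, mul_apply, hadamard_apply]
  refine Finset.sum_congr rfl fun i _ => Finset.sum_congr rfl fun j _ => ?_
  rw [hG.apply i j]
  ring

theorem screenedW_eq_inv_mul {N : ℕ} (G v : Matrix (Fin N) (Fin N) ℝ) (hv : IsUnit v.det) :
    screenedW G v = (1 + (1 / 2 : ℝ) • (v * hadamard G G))⁻¹ * v := by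
  have hfactor : v⁻¹ + (1 / 2 : ℝ) • hadamard G G =
      v⁻¹ * (1 + (1 / 2 : ℝ) • (v * hadamard G G)) := by
    rw [mul_add, mul_one, mul_smul_comm, nonsing_inv_mul_cancel_left _ _ hv]
  rw [screenedW, hfactor, Matrix.mul_inv_rev, nonsing_inv_nonsing_inv _ hv]

theorem hasDerivAt_hadamard_self_line {n : Type*} (G H : Matrix n n ℝ) (i j : n) :
    HasDerivAt (fun t : ℝ => hadamard (G + t • H) (G + t • H) i j)
      (((2 : ℝ) • hadamard G H) i j) 0 := by
  have h : HasDerivAt (fun t : ℝ => G i j + t * H i j) (H i j) 0 := by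
    simpa using ((hasDerivAt_id (0 : ℝ)).mul_const (H i j)).const_add (G i j)
  convert! h.mul h using 1
  simp only [Matrix.smul_apply, hadamard_apply, smul_eq_mul]
  ring

theorem hasDerivAt_one_add_half_smul_mul_hadamard_self_line {n : Type*} [Fintype n]
    [DecidableEq n] (G v H : Matrix n n ℝ) (i j : n) :
    HasDerivAt
      (fun t : ℝ => (1 + (1 / 2 : ℝ) • (v * hadamard (G + t • H) (G + t • H))) i j)
      ((v * hadamard G H) i j) 0 := by
  have h := ((HasDerivAt.fun_sum (u := Finset.univ) fun k _ =>
    (hasDerivAt_hadamard_self_line G H k j).const_mul (v i k)).const_mul (1 / 2 : ℝ)).const_add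
      ((1 : Matrix n n ℝ) i j)
  convert! h using 1
  simp only [Matrix.smul_apply, mul_apply, smul_eq_mul, Finset.mul_sum]
  exact Finset.sum_congr rfl fun k _ => by ring

/-- **Φ-derivability of the GW approximation**: if `v` is symmetric and invertible, `G`
is symmetric and `det(I + (1/2) v(G⊙G)) ≠ 0`, then for every symmetric direction `H`,
the derivative of `t ↦ det(I + (1/2) v((G+tH)⊙(G+tH)))` at `t = 0` equals
`det(I + (1/2) v(G⊙G)) · Tr((G⊙W) H)`; in particular, wherever this determinant is
positive, the directional derivative of `Φ(G) = log det(I + (1/2) v(G⊙G))` in the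
symmetric direction `H` is `Tr((G⊙W) H)`. -/
theorem gw_phi_derivability {N : ℕ} (hN : 1 ≤ N) (G v : Matrix (Fin N) (Fin N) ℝ)
    (hG : G.IsSymm) (hv : v.IsSymm) (hvu : IsUnit v.det)
    (hdet : (1 + (1 / 2 : ℝ) • (v * hadamard G G)).det ≠ 0)
    (H : Matrix (Fin N) (Fin N) ℝ) (hH : H.IsSymm) :
    HasDerivAt
        (fun t : ℝ => (1 + (1 / 2 : ℝ) • (v * hadamard (G + t • H) (G + t • H))).det)
        ((1 + (1 / 2 : ℝ) • (v * hadamard G G)).det *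
          (hadamard G (screenedW G v) * H).trace) 0 ∧
    (0 < (1 + (1 / 2 : ℝ) • (v * hadamard G G)).det →
      HasDerivAt
        (fun t : ℝ =>
          Real.log (1 + (1 / 2 : ℝ) • (v * hadamard (G + t • H) (G + t • H))).det)
        ((hadamard G (screenedW G v) * H).trace) 0) := by
  set A := 1 + (1 / 2 : ℝ) • (v * hadamard G G) with hA
  have hadj : A.adjugate = A.det • A⁻¹ := by
    rw [inv_def, smul_smul, Ring.mul_inverse_cancel _ hdet.isUnit, one_smul]
  have hderiv : HasDerivAt
      (fun t : ℝ => (1 + (1 / 2 : ℝ) • (v * hadamard (G + t • H) (G + t • H))).det)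
      (A.det * (hadamard G (screenedW G v) * H).trace) 0 := by
    convert! hasDerivAt_det (hasDerivAt_one_add_half_smul_mul_hadamard_self_line G v H) using 1
    rw [zero_smul, add_zero, ← hA, hadj, smul_mul_assoc, trace_smul, smul_eq_mul,
      ← mul_assoc A⁻¹, ← screenedW_eq_inv_mul G v hvu, trace_mul_hadamard_of_isSymm hG]
  refine ⟨hderiv, fun _ => ?_⟩
  have hlog := hderiv.log (by simpa [hA] using hdet)
  simp only [zero_smul, add_zero, ← hA, mul_div_cancel_left₀ _ hdet] at hlog
  exact hlog
end
end
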